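/- arXiv:1312.5436 — 4 statements merged into one kernel-verified Lean document; each statement's English description precedes it below -/
import Mathlib

section
/- Let L be a finite collection of lines in R^3 and let x be a joint of multiplicity N for L (i.e., N is the number of unordered triples of lines of L through x whose directions span R^3), such that at most 2k lines of L pass through x. If L' is a subcollection of L such that x is a joint for L' of multiplicity at most N/2 (or not a joint for L' at all), then at least N/(1000·k^2) lines of L \ L' pass through x. -/
attribute [local instance] Classical.propDecidable

/-- `x` lies on the line given by the (point, direction) pair `l`. -/
def onLine (x : Fin 3 → ℝ) (l : (Fin 3 → ℝ) × (Fin 3 → ℝ)) : Prop :=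
  ∃ t : ℝ, x = l.1 + t • l.2

/-- The lines of the collection `L` passing through `x`. -/
noncomputable def linesThrough (L : Finset ((Fin 3 → ℝ) × (Fin 3 → ℝ))) (x : Fin 3 → ℝ) :
    Finset ((Fin 3 → ℝ) × (Fin 3 → ℝ)) :=
  L.filter (fun l => onLine x l)

/-- The multiplicity of `x` as a joint for `L`: the number of unordered triples of lines
of `L` through `x` whose directions span `ℝ³`. -/
noncomputable def jointMult (L : Finset ((Fin 3 → ℝ) × (Fin 3 → ℝ))) (x : Fin 3 → ℝ) : ℕ :=
  ((Finset.powersetCard 3 (linesThrough L x)).filter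
    (fun T => Submodule.span ℝ ((T.image Prod.snd : Finset (Fin 3 → ℝ)) : Set (Fin 3 → ℝ)) = ⊤)).card

/-- A triple in `A` either lies in `B` or is determined by an element of `A \ B` and a pair in
`A`. -/
theorem powersetCard_three_subset {α : Type*} [DecidableEq α] (A B : Finset α) :
    Finset.powersetCard 3 A ⊆ Finset.powersetCard 3 B ∪
      ((A \ B) ×ˢ A ×ˢ A).image (fun p => {p.1, p.2.1, p.2.2}) := by
  intro T hT
  rw [Finset.mem_powersetCard] at hT
  obtain ⟨hTA, hcard⟩ := hT
  rw [Finset.mem_union, Finset.mem_powersetCard]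
  by_cases hTB : T ⊆ B
  · exact Or.inl ⟨hTB, hcard⟩
  · right
    obtain ⟨d, hdT, hdB⟩ := Finset.not_subset.mp hTB
    have herase : (T.erase d).card = 2 := by rw [Finset.card_erase_of_mem hdT, hcard]
    obtain ⟨a, b, -, hab⟩ := Finset.card_eq_two.mp herase
    have hT : T = {d, a, b} := by rw [← Finset.insert_erase hdT, hab]
    subst hT
    rw [Finset.mem_image]
    refine ⟨(d, a, b), ?_, rfl⟩
    simp only [Finset.mem_product, Finset.mem_sdiff]
    exact ⟨⟨hTA (by simp), hdB⟩, hTA (by simp), hTA (by simp)⟩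

theorem card_filter_powersetCard_three_le {α : Type*} [DecidableEq α] (A B : Finset α)
    (P : Finset α → Prop) [DecidablePred P] :
    ((Finset.powersetCard 3 A).filter P).card ≤
      ((Finset.powersetCard 3 B).filter P).card + (A \ B).card * A.card ^ 2 := by
  have hsub := Finset.filter_subset_filter P (powersetCard_three_subset A B)
  rw [Finset.filter_union] at hsub
  refine (Finset.card_le_card hsub).trans ((Finset.card_union_le _ _).trans ?_)
  refine Nat.add_le_add_left ((Finset.card_filter_le _ _).trans
    (Finset.card_image_le.trans_eq ?_)) _
  rw [Finset.card_product, Finset.card_product, sq]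

theorem linesThrough_sdiff (L L' : Finset ((Fin 3 → ℝ) × (Fin 3 → ℝ))) (x : Fin 3 → ℝ) :
    linesThrough (L \ L') x = linesThrough L x \ linesThrough L' x := by
  ext l
  simp only [linesThrough, Finset.mem_filter, Finset.mem_sdiff]
  tauto

theorem stmt0 (L : Finset ((Fin 3 → ℝ) × (Fin 3 → ℝ)))
    (hL : ∀ l ∈ L, l.2 ≠ 0)
    (x : Fin 3 → ℝ) (N k : ℕ)
    (hN : jointMult L x = N) (hjoint : 1 ≤ N)
    (hk : (linesThrough L x).card ≤ 2 * k)
    (L' : Finset ((Fin 3 → ℝ) × (Fin 3 → ℝ))) (hL' : L' ⊆ L)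
    (hmult : 2 * jointMult L' x ≤ N) :
    N ≤ 1000 * k ^ 2 * (linesThrough (L \ L') x).card := by
  have hcount : jointMult L x ≤
      jointMult L' x + (linesThrough L x \ linesThrough L' x).card * (linesThrough L x).card ^ 2 :=
    card_filter_powersetCard_three_le _ _ _
  rw [← linesThrough_sdiff, hN] at hcount
  have hbound : (linesThrough (L \ L') x).card * (linesThrough L x).card ^ 2 ≤
      (linesThrough (L \ L') x).card * (2 * k) ^ 2 := by gcongr
  nlinarith [Nat.zero_le (k ^ 2 * (linesThrough (L \ L') x).card)]
end

section
/- Let d be a positive integer and let G be a finite set of points in R^n with |G| = S. Set M = C(d+n, n) - 1. Then there exists a nonzero polynomial p in R[x_1,...,x_n] of degree at most d whose zero set bisects each of any given M pairwise disjoint finite sets of points S_1, ..., S_M in R^n, where 'bisects' means each of the sets S_i ∩ {p > 0} and S_i ∩ {p < 0} contains at most half of the points of S_i. -/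
attribute [local instance] Classical.propDecidable

namespace HamSandwich

open Filter Topology

/-- A real function on the index set of a coloured family sums to zero over every colour class. -/
def Balanced {ι : Type*} [Fintype ι] {M : ℕ} (c : ι → Fin M) (h : ι → ℤ) : Prop :=
  ∀ i, ∑ b with c b = i, h b = 0

/-- The parity of the number of balanced transversals of a colouring. -/
noncomputable def parity {ι : Type*} [Fintype ι] {M : ℕ} (c : ι → Fin M)
    (h : (Fin M → ι) → ι → ℤ) : ZMod 2 :=
  ∑ σ with ∀ i, c (σ i) = i, if Balanced c (h σ) then 1 else 0

/-- The determinant with rows `x b, x (σ 0), …, x (σ (M - 1))`. -/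
noncomputable def bracket {ι : Type*} {M : ℕ} (x : ι → Fin (M + 1) → ℝ) (σ : Fin M → ι)
    (b : ι) : ℝ :=
  Matrix.detRowAlternating (x ∘ (Fin.cons b σ : Fin (M + 1) → ι))

/-- The parity of the number of transversals spanning a hyperplane that balances every class. -/
noncomputable def bisectorParity {ι : Type*} [Fintype ι] {M : ℕ} (c : ι → Fin M)
    (x : ι → Fin (M + 1) → ℝ) : ZMod 2 :=
  parity c fun σ b => (SignType.sign (bracket x σ b) : ℤ)

/-- Any `M + 1` vectors of the family are linearly independent. -/
def GeneralPosition {ι : Type*} {M : ℕ} (x : ι → Fin (M + 1) → ℝ) : Prop :=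
  ∀ f : Fin (M + 1) → ι, Function.Injective f → Matrix.detRowAlternating (x ∘ f) ≠ 0

section Combinatorics

variable {ι : Type*} [Fintype ι] {M : ℕ} {c : ι → Fin M}

lemma sum_class_add {m t : ι → ℤ} {b : ι} (hb : ∀ e, t e ≠ 0 → e = b) (i : Fin M) :
    ∑ e with c e = i, (m e + t e) = ∑ e with c e = i, m e + if i = c b then t b else 0 := by
  rw [Finset.sum_add_distrib]
  congr 1
  split_ifs with h
  · subst h
    refine Finset.sum_eq_single b (fun e _ he => ?_) (by simp)
    by_contra h0
    exact he (hb e h0)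
  · refine Finset.sum_eq_zero fun e he => ?_
    by_contra h0
    rw [hb e h0] at he
    exact h (Finset.mem_filter.1 he).2.symm

lemma indicator_add_indicator {m t : ι → ℤ} {b : ι} (hb : ∀ e, t e ≠ 0 → e = b)
    (hu : t b = 1 ∨ t b = -1) :
    ((if Balanced c (m + t) then 1 else 0) + (if Balanced c (m - t) then 1 else 0) : ZMod 2) =
      if (∀ i ≠ c b, ∑ e with c e = i, m e = 0) ∧
        (∑ e with c e = c b, m e = 1 ∨ ∑ e with c e = c b, m e = -1) then 1 else 0 := by
  have h1 : Balanced c (m + t) ↔ (∀ i ≠ c b, ∑ e with c e = i, m e = 0) ∧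
      ∑ e with c e = c b, m e = - t b := by
    constructor
    · intro h
      refine ⟨fun i hi => ?_, ?_⟩
      · have := h i
        simp only [Pi.add_apply] at this
        rw [sum_class_add hb, if_neg hi] at this
        simpa using this
      · have := h (c b)
        simp only [Pi.add_apply] at this
        rw [sum_class_add hb, if_pos rfl] at this
        linarith
    · rintro ⟨h, h'⟩ i
      simp only [Pi.add_apply]
      rw [sum_class_add hb]
      split_ifs with hi
      · rw [hi, h']; ring
      · rw [h i hi]; rfl
  have hb' : ∀ e, (-t) e ≠ 0 → e = b := fun e he => hb e (by simpa using he)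
  have h2 : Balanced c (m - t) ↔ (∀ i ≠ c b, ∑ e with c e = i, m e = 0) ∧
      ∑ e with c e = c b, m e = t b := by
    rw [sub_eq_add_neg]
    constructor
    · intro h
      refine ⟨fun i hi => ?_, ?_⟩
      · have := h i
        simp only [Pi.add_apply] at this
        rw [sum_class_add hb', if_neg hi] at this
        simpa using this
      · have := h (c b)
        simp only [Pi.add_apply] at this
        rw [sum_class_add hb', if_pos rfl] at this
        simp only [Pi.neg_apply] at this
        linarith
    · rintro ⟨h, h'⟩ i
      simp only [Pi.add_apply]
      rw [sum_class_add hb']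
      split_ifs with hi
      · rw [hi, h', Pi.neg_apply]; ring
      · rw [h i hi]; rfl
  rw [if_congr h1 rfl rfl, if_congr h2 rfl rfl]
  generalize (∑ e with c e = c b, m e) = A
  rcases hu with hu | hu <;> rw [hu] <;> split_ifs <;> first | rfl | (exfalso; grind)

/-- Exchanging the two elements of a doubled colour class pairs up the transversals whose
balancedness changes. -/
lemma parity_add_eq_parity_sub {m t : (Fin M → ι) → ι → ℤ}
    (ht : ∀ σ : Fin M → ι, (∀ i, c (σ i) = i) → ∀ b, t σ b ≠ 0 →
      (t σ b = 1 ∨ t σ b = -1) ∧ (∀ e, t σ e ≠ 0 → e = b) ∧ b ≠ σ (c b) ∧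
      t (Function.update σ (c b) b) (σ (c b)) ≠ 0 ∧
      ∃ u : ℤ, (u = 1 ∨ u = -1) ∧ ∀ e, m (Function.update σ (c b) b) e = u * m σ e) :
    parity c (m + t) = parity c (m - t) := by
  have key : parity c (m + t) + parity c (m - t) = 0 := by
    unfold parity
    rw [← Finset.sum_add_distrib]
    set f : (Fin M → ι) → ZMod 2 := fun σ =>
      ((if Balanced c ((m + t) σ) then 1 else 0) + (if Balanced c ((m - t) σ) then 1 else 0))
      with hf
    let g : (Fin M → ι) → (Fin M → ι) := fun σ =>
      if h : ∃ b, t σ b ≠ 0 then Function.update σ (c h.choose) h.choose else σ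
    have hg : ∀ σ : Fin M → ι, (∀ i, c (σ i) = i) → ∀ b, t σ b ≠ 0 →
        g σ = Function.update σ (c b) b := by
      intro σ hσ b hb
      have h : ∃ b, t σ b ≠ 0 := ⟨b, hb⟩
      have h1 : h.choose = b := (ht σ hσ b hb).2.1 _ h.choose_spec
      simp only [g, dif_pos h, h1]
    have hg0 : ∀ σ : Fin M → ι, (¬ ∃ b, t σ b ≠ 0) → g σ = σ := by
      intro σ h
      simp only [g, dif_neg h]
    have hmem : ∀ σ : Fin M → ι, (∀ i, c (σ i) = i) → ∀ i, c (g σ i) = i := by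
      intro σ hσ i
      by_cases h : ∃ b, t σ b ≠ 0
      · obtain ⟨b, hb⟩ := h
        rw [hg σ hσ b hb]
        by_cases hi : i = c b
        · subst hi; simp
        · simp [Function.update_of_ne hi, hσ]
      · rw [hg0 σ h, hσ]
    have hf0 : ∀ σ : Fin M → ι, (¬ ∃ b, t σ b ≠ 0) → f σ = 0 := by
      intro σ h
      have : t σ = 0 := by
        ext b
        by_contra hb
        exact h ⟨b, hb⟩
      simp only [hf, Pi.add_apply, Pi.sub_apply, this, add_zero, sub_zero]
      exact CharTwo.add_self_eq_zero _
    change ∑ σ with ∀ i, c (σ i) = i, f σ = 0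
    refine Finset.sum_involution (fun σ _ => g σ) ?_ ?_ ?_ ?_
    · intro σ hσ
      replace hσ := (Finset.mem_filter.1 hσ).2
      by_cases h : ∃ b, t σ b ≠ 0
      · obtain ⟨b, hb⟩ := h
        obtain ⟨h1, h2, h3, h4, u, hu, hum⟩ := ht σ hσ b hb
        have hσ' := hmem σ hσ
        rw [hg σ hσ b hb] at hσ' ⊢
        obtain ⟨h1', h2', -⟩ := ht _ hσ' _ h4
        suffices f σ = f (Function.update σ (c b) b) by
          rw [← this]; exact CharTwo.add_self_eq_zero _
        simp only [hf, Pi.add_apply, Pi.sub_apply]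
        rw [indicator_add_indicator h2 h1, indicator_add_indicator h2' h1', hσ (c b)]
        simp only [hum, ← Finset.mul_sum]
        refine if_congr ?_ rfl rfl
        rcases hu with rfl | rfl
        · simp
        · simp only [neg_one_mul, neg_eq_zero, neg_inj]
          rw [neg_eq_iff_eq_neg]
          tauto
      · rw [hg0 σ h, hf0 σ h, add_zero]
    · intro σ hσ h0
      replace hσ := (Finset.mem_filter.1 hσ).2
      by_cases h : ∃ b, t σ b ≠ 0
      · obtain ⟨b, hb⟩ := h
        rw [hg σ hσ b hb]
        intro heq
        have := congrFun heq (c b)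
        rw [Function.update_self] at this
        exact (ht σ hσ b hb).2.2.1 this
      · exact absurd (hf0 σ h) h0
    · intro σ hσ
      replace hσ := (Finset.mem_filter.1 hσ).2
      exact Finset.mem_filter.2 ⟨Finset.mem_univ _, hmem σ hσ⟩
    · intro σ hσ
      replace hσ := (Finset.mem_filter.1 hσ).2
      by_cases h : ∃ b, t σ b ≠ 0
      · obtain ⟨b, hb⟩ := h
        obtain ⟨-, -, h3, h4, -⟩ := ht σ hσ b hb
        have hσ' := hmem σ hσ
        rw [hg σ hσ b hb] at hσ' ⊢
        rw [hg _ hσ' _ h4, hσ (c b)]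
        simp
      · simp only [hg0 σ h]
  exact CharTwo.add_eq_zero.1 key

end Combinatorics

section Crossing

variable {ι : Type*} {M : ℕ}

lemma cons_injective_of_transversal {c : ι → Fin M} {σ : Fin M → ι} (hσ : ∀ i, c (σ i) = i)
    {b : ι} (hb : b ∉ Set.range σ) : Function.Injective (Fin.cons b σ : Fin (M + 1) → ι) :=
  Fin.cons_injective_iff.2 ⟨hb, Function.LeftInverse.injective hσ⟩

lemma bracket_eq_zero_of_mem_range (x : ι → Fin (M + 1) → ℝ) (σ : Fin M → ι) {b : ι}
    (hb : b ∈ Set.range σ) : bracket x σ b = 0 := by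
  obtain ⟨i, rfl⟩ := hb
  exact Matrix.detRowAlternating.map_eq_zero_of_eq _ (i := 0) (j := i.succ) (by simp)
    (Fin.succ_ne_zero i).symm

/-- Two hyperplanes spanned by `M` vectors each out of a dependent `(M + 1)`-tuple coincide. -/
lemma exists_bracket_update_eq_mul (y : ι → Fin (M + 1) → ℝ) (σ : Fin M → ι) {b e : ι}
    (hb : bracket y σ b = 0) (he : bracket y σ e ≠ 0) (i : Fin M) :
    ∃ r : ℝ, ∀ u, bracket y (Function.update σ i b) u = r * bracket y σ u := by
  let A : ι → Matrix (Fin (M + 1)) (Fin (M + 1)) ℝ := fun u =>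
    y ∘ (Fin.cons u σ : Fin (M + 1) → ι)
  have hA : ∀ u, bracket y σ u = (A u).det := fun u => rfl
  rw [hA] at he
  set a : Fin (M + 1) → ℝ := Matrix.vecMul (y b) (A e)⁻¹ with ha
  have hya : y b = ∑ k, a k • A e k := by
    have h1 : Matrix.vecMul a (A e) = y b := by
      rw [ha, Matrix.vecMul_vecMul, Matrix.nonsing_inv_mul _ (isUnit_iff_ne_zero.2 he),
        Matrix.vecMul_one]
    rw [← h1, Matrix.vecMul_eq_sum]
  have h0 : a 0 = 0 := by
    have h1 : (A b).det = a 0 • (A e).det := by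
      rw [← Matrix.det_updateRow_sum, ← hya]
      congr 1
      ext k : 1
      refine Fin.cases ?_ (fun i => ?_) k
      · rw [Matrix.updateRow_self]
        rfl
      · rw [Matrix.updateRow_ne (Fin.succ_ne_zero i)]
        rfl
    rw [← hA, hb] at h1
    simpa [he] using h1.symm
  refine ⟨a i.succ, fun u => ?_⟩
  have hyu : y b = ∑ k, a k • A u k := by
    rw [hya, Fin.sum_univ_succ, Fin.sum_univ_succ, h0]
    simp [A]
  rw [hA, ← smul_eq_mul, ← Matrix.det_updateRow_sum, ← hyu]
  change Matrix.det _ = _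
  congr 1
  ext k : 1
  refine Fin.cases ?_ (fun l => ?_) k
  · rw [Matrix.updateRow_ne (Fin.succ_ne_zero i).symm]
    rfl
  · by_cases hl : l = i
    · subst hl
      rw [Matrix.updateRow_self]
      change y (Function.update σ l b l) _ = y b _
      rw [Function.update_self]
    · rw [Matrix.updateRow_ne (by simpa using hl)]
      change y (Function.update σ i b l) _ = y (σ l) _
      rw [Function.update_of_ne hl]

/-- The family in which the `j`-th vector moves along the line from its position to `z`. -/
noncomputable def moveLine (x : ι → Fin (M + 1) → ℝ) (j : ι) (z : Fin (M + 1) → ℝ) (s : ℝ) :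
    ι → Fin (M + 1) → ℝ :=
  Function.update x j (x j + s • (z - x j))

@[simp] lemma moveLine_zero (x : ι → Fin (M + 1) → ℝ) (j : ι) (z : Fin (M + 1) → ℝ) :
    moveLine x j z 0 = x := by
  simp [moveLine]

@[simp] lemma moveLine_one (x : ι → Fin (M + 1) → ℝ) (j : ι) (z : Fin (M + 1) → ℝ) :
    moveLine x j z 1 = Function.update x j z := by
  simp [moveLine]

/-- The determinant of `M + 1` members of the family as a linear function of the vector in
position `k`. -/
noncomputable def slotDet (x : ι → Fin (M + 1) → ℝ) (f : Fin (M + 1) → ι) (k : Fin (M + 1)) :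
    (Fin (M + 1) → ℝ) →ₗ[ℝ] ℝ :=
  Matrix.detRowAlternating.toMultilinearMap.toLinearMap (x ∘ f) k

lemma slotDet_apply_of_injective (x : ι → Fin (M + 1) → ℝ) {f : Fin (M + 1) → ι}
    (hf : Function.Injective f) (k : Fin (M + 1)) (z : Fin (M + 1) → ℝ) :
    Matrix.detRowAlternating (Function.update x (f k) z ∘ f) = slotDet x f k z := by
  rw [Function.update_comp_eq_of_injective _ hf]
  rfl

lemma slotDet_apply_apply (x : ι → Fin (M + 1) → ℝ) (f : Fin (M + 1) → ι) (k : Fin (M + 1))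
    (e : ι) : slotDet x f k (x e) = Matrix.detRowAlternating (x ∘ Function.update f k e) := by
  rw [Function.comp_update]
  rfl

lemma slotDet_self (x : ι → Fin (M + 1) → ℝ) (f : Fin (M + 1) → ι) (k : Fin (M + 1)) :
    slotDet x f k (x (f k)) = Matrix.detRowAlternating (x ∘ f) := by
  rw [slotDet_apply_apply, Function.update_eq_self]

lemma exists_det_moveLine_affine (x : ι → Fin (M + 1) → ℝ) (j : ι) (z : Fin (M + 1) → ℝ)
    (f : Fin (M + 1) → ι) :
    ∃ p q : ℝ, ∀ s, Matrix.detRowAlternating (moveLine x j z s ∘ f) = p + s * q := by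
  by_cases hf : Function.Injective f
  · by_cases hj : j ∈ Set.range f
    · obtain ⟨k, rfl⟩ := hj
      refine ⟨slotDet x f k (x (f k)), slotDet x f k (z - x (f k)), fun s => ?_⟩
      rw [moveLine, slotDet_apply_of_injective x hf, map_add, map_smul, smul_eq_mul]
    · refine ⟨Matrix.detRowAlternating (x ∘ f), 0, fun s => ?_⟩
      rw [moveLine, Function.update_comp_eq_of_notMem_range _ _ hj, mul_zero, add_zero]
  · refine ⟨0, 0, fun s => ?_⟩
    rw [Matrix.detRowAlternating.map_eq_zero_of_not_injective]
    · simp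
    · exact fun h => hf h.of_comp

lemma eventually_sign_eq {X : Type*} [TopologicalSpace X] {f : X → ℝ} {a : X}
    (hf : ContinuousAt f a) (h : f a ≠ 0) :
    ∀ᶠ s in 𝓝 a, SignType.sign (f s) = SignType.sign (f a) := by
  have := ContinuousAt.comp (f := f) (continuousAt_sign_of_ne_zero h) hf
  rw [ContinuousAt, nhds_discrete SignType, tendsto_pure] at this
  exact this

/-- If every instant of the motion makes at most one `(M + 1)`-subset dependent, then the parity
is the same just before and just after each instant. -/
lemma exists_eventually_bisectorParity_eq [Fintype ι] {c : ι → Fin M}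
    {x : ι → Fin (M + 1) → ℝ} (hx : GeneralPosition x) {j : ι} {z : Fin (M + 1) → ℝ}
    (hu : ∀ s, ∀ f g : Fin (M + 1) → ι, Function.Injective f → Function.Injective g →
      Matrix.detRowAlternating (moveLine x j z s ∘ f) = 0 →
      Matrix.detRowAlternating (moveLine x j z s ∘ g) = 0 → Set.range f = Set.range g)
    (s₀ : ℝ) :
    ∃ q, ∀ᶠ s in 𝓝[≠] s₀, bisectorParity c (moveLine x j z s) = q := by
  choose p q hpq using fun σ b => exists_det_moveLine_affine x j z (Fin.cons (α := fun _ => ι) b σ)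
  replace hpq : ∀ σ b s, bracket (moveLine x j z s) σ b = p σ b + s * q σ b := hpq
  set y := moveLine x j z s₀ with hy
  let m : (Fin M → ι) → ι → ℤ := fun σ b => (SignType.sign (bracket y σ b) : ℤ)
  let t : (Fin M → ι) → ι → ℤ := fun σ b =>
    if bracket y σ b = 0 then (SignType.sign (q σ b) : ℤ) else 0
  have haff : ∀ σ b s, bracket (moveLine x j z s) σ b = bracket y σ b + (s - s₀) * q σ b := by
    intro σ b s
    rw [hpq, hy, hpq]
    ring
  have ht0 : ∀ σ b, t σ b ≠ 0 → bracket y σ b = 0 ∧ q σ b ≠ 0 := by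
    intro σ b h
    simp only [t] at h
    split_ifs at h with h0
    · exact ⟨h0, fun hq => h (by simp [hq])⟩
    · exact absurd rfl h
  have hmem : ∀ σ b, q σ b ≠ 0 → b ∉ Set.range σ := by
    intro σ b hq hb
    have h0 := hpq σ b 0
    have h1 := hpq σ b 1
    rw [bracket_eq_zero_of_mem_range _ _ hb] at h0 h1
    apply hq
    linarith
  have hq0 : ∀ σ : Fin M → ι, (∀ i, c (σ i) = i) → ∀ b, b ∉ Set.range σ → bracket y σ b = 0 →
      q σ b ≠ 0 := by
    intro σ hσ b hb h0 hq
    have h1 := haff σ b 0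
    rw [h0, hq, moveLine_zero] at h1
    exact hx _ (cons_injective_of_transversal hσ hb) (by simpa [bracket] using h1)
  have hconst : ∀ σ b, bracket y σ b ≠ 0 → ∀ᶠ s in 𝓝 s₀,
      SignType.sign (bracket (moveLine x j z s) σ b) = SignType.sign (bracket y σ b) := by
    intro σ b h0
    refine eventually_sign_eq (f := fun s => bracket (moveLine x j z s) σ b) ?_ h0
    simp only [haff]
    fun_prop
  have hright : ∀ᶠ s in 𝓝[>] s₀, bisectorParity c (moveLine x j z s) = parity c (m + t) := by
    have h : ∀ᶠ s in 𝓝[>] s₀, ∀ σ b,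
        (SignType.sign (bracket (moveLine x j z s) σ b) : ℤ) = (m + t) σ b := by
      refine eventually_all.2 fun σ => eventually_all.2 fun b => ?_
      by_cases h0 : bracket y σ b = 0
      · filter_upwards [self_mem_nhdsWithin] with s hs
        have hs' : 0 < s - s₀ := sub_pos.2 hs
        simp [m, t, haff, h0, sign_mul, sign_pos hs']
      · filter_upwards [nhdsWithin_le_nhds (hconst σ b h0)] with s hs
        simp [m, t, hs, h0]
    filter_upwards [h] with s hs
    exact congrArg (parity c) (funext₂ hs)
  have hleft : ∀ᶠ s in 𝓝[<] s₀, bisectorParity c (moveLine x j z s) = parity c (m - t) := by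
    have h : ∀ᶠ s in 𝓝[<] s₀, ∀ σ b,
        (SignType.sign (bracket (moveLine x j z s) σ b) : ℤ) = (m - t) σ b := by
      refine eventually_all.2 fun σ => eventually_all.2 fun b => ?_
      by_cases h0 : bracket y σ b = 0
      · filter_upwards [self_mem_nhdsWithin] with s hs
        have hs' : s - s₀ < 0 := sub_neg.2 hs
        simp [m, t, haff, h0, sign_mul, sign_neg hs']
      · filter_upwards [nhdsWithin_le_nhds (hconst σ b h0)] with s hs
        simp [m, t, hs, h0]
    filter_upwards [h] with s hs
    exact congrArg (parity c) (funext₂ hs)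
  have hcross : parity c (m + t) = parity c (m - t) := by
    refine parity_add_eq_parity_sub fun σ hσ b hb => ?_
    obtain ⟨h0, hq⟩ := ht0 σ b hb
    have hbσ := hmem σ b hq
    have huniq : ∀ τ : Fin M → ι, (∀ i, c (τ i) = i) → ∀ e, e ∉ Set.range τ →
        bracket y τ e = 0 → insert b (Set.range σ) = insert e (Set.range τ) := by
      intro τ hτ e he h
      have := hu s₀ _ _ (cons_injective_of_transversal hσ hbσ)
        (cons_injective_of_transversal hτ he) h0 h
      rwa [Fin.range_cons, Fin.range_cons] at this
    set σ' := Function.update σ (c b) b with hσ'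
    have hσ't : ∀ i, c (σ' i) = i := by
      intro i
      by_cases hi : i = c b
      · subst hi; simp [hσ']
      · simp [hσ', Function.update_of_ne hi, hσ]
    have hne : b ≠ σ (c b) := fun h => hbσ ⟨_, h.symm⟩
    have hmem' : σ (c b) ∉ Set.range σ' := by
      rintro ⟨i, hi⟩
      have h1 : i = c b := by rw [← hσ't i, hi, hσ]
      subst h1
      rw [hσ', Function.update_self] at hi
      exact hne hi
    have hrange : insert (σ (c b)) (Set.range σ') = insert b (Set.range σ) := by
      ext e
      simp only [Set.mem_insert_iff, Set.mem_range]
      constructor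
      · rintro (rfl | ⟨i, rfl⟩)
        · exact Or.inr ⟨_, rfl⟩
        · by_cases hi : i = c b
          · subst hi; simp [hσ']
          · simp [hσ', Function.update_of_ne hi]
      · rintro (rfl | ⟨i, rfl⟩)
        · exact Or.inr ⟨c e, by simp [hσ']⟩
        · by_cases hi : i = c b
          · exact Or.inl (by rw [hi])
          · exact Or.inr ⟨i, by simp [hσ', Function.update_of_ne hi]⟩
    have h0' : bracket y σ' (σ (c b)) = 0 := by
      have hswap : y ∘ (Fin.cons (σ (c b)) σ' : Fin (M + 1) → ι) =
          (y ∘ (Fin.cons b σ : Fin (M + 1) → ι)) ∘ Equiv.swap 0 (c b).succ := by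
        ext k : 1
        refine Fin.cases ?_ (fun i => ?_) k
        · simp
        · by_cases hi : i = c b
          · subst hi; simp [hσ']
          · rw [Function.comp_apply, Function.comp_apply,
              Equiv.swap_apply_of_ne_of_ne (Fin.succ_ne_zero i) (by simpa using hi)]
            simp [hσ', Function.update_of_ne hi]
      rw [bracket, hswap, AlternatingMap.map_swap _ _ (Fin.succ_ne_zero _).symm, neg_eq_zero]
      exact h0
    have hzero : ∀ e, bracket y σ' e = 0 ↔ bracket y σ e = 0 := by
      have hmem_iff : ∀ e, e ∈ insert b (Set.range σ) → bracket y σ e = 0 := by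
        rintro e (rfl | he)
        exacts [h0, bracket_eq_zero_of_mem_range _ _ he]
      have hmem_iff' : ∀ e, e ∈ insert b (Set.range σ) → bracket y σ' e = 0 := by
        intro e he
        rw [← hrange] at he
        rcases he with rfl | he
        exacts [h0', bracket_eq_zero_of_mem_range _ _ he]
      intro e
      constructor
      · intro he
        apply hmem_iff
        by_cases h : e ∈ Set.range σ'
        · rw [← hrange]; exact Or.inr h
        · rw [huniq σ' hσ't e h he]; exact Or.inl rfl
      · intro he
        apply hmem_iff'
        by_cases h : e ∈ Set.range σ
        · exact Or.inr h
        · rw [huniq σ hσ e h he]; exact Or.inl rfl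
    refine ⟨?_, fun e he => ?_, hne, ?_, ?_⟩
    · simp only [t, if_pos h0]
      rcases lt_or_gt_of_ne hq with h | h
      · exact Or.inr (by rw [sign_neg h]; rfl)
      · exact Or.inl (by rw [sign_pos h]; rfl)
    · obtain ⟨he0, heq⟩ := ht0 σ e he
      have h1 := huniq σ hσ e (hmem σ e heq) he0
      have h2 : e ∈ insert b (Set.range σ) := by rw [h1]; exact Or.inl rfl
      exact h2.resolve_right (hmem σ e heq)
    · have h1 := hq0 σ' hσ't _ hmem' h0'
      simp only [t, if_pos h0']
      rcases lt_or_gt_of_ne h1 with h | h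
      · rw [sign_neg h]; decide
      · rw [sign_pos h]; decide
    · by_cases hex : ∃ e, bracket y σ e ≠ 0
      · obtain ⟨e, he⟩ := hex
        obtain ⟨r, hr⟩ := exists_bracket_update_eq_mul y σ h0 he (c b)
        have hr0 : r ≠ 0 := by
          rintro rfl
          exact he ((hzero e).1 (by rw [hr, zero_mul]))
        refine ⟨(SignType.sign r : ℤ), ?_, fun e => ?_⟩
        · rcases lt_or_gt_of_ne hr0 with h | h
          · exact Or.inr (by rw [sign_neg h]; rfl)
          · exact Or.inl (by rw [sign_pos h]; rfl)
        · simp [m, hσ', hr, sign_mul]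
      · push Not at hex
        exact ⟨1, Or.inl rfl, fun e => by simp [m, hex, (hzero e).2 (hex e)]⟩
  refine ⟨parity c (m + t), ?_⟩
  rw [← Set.Iio_union_Ioi, nhdsWithin_union, eventually_sup]
  exact ⟨hcross ▸ hleft, hright⟩

end Crossing

section Deformation

variable {ι : Type*} {M : ℕ}

lemma exists_dist_lt_forall_apply_ne_zero {N : ℕ} {κ : Type*} [Finite κ]
    (φ : κ → (Fin N → ℝ) →ₗ[ℝ] ℝ) (y : Fin N → ℝ) {ε : ℝ} (hε : 0 < ε) :
    ∃ z, dist z y < ε ∧ ∀ k, φ k ≠ 0 → φ k z ≠ 0 := by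
  have hd : Dense (⋂ k : {k // φ k ≠ 0}, {z | φ k z ≠ 0}) := by
    refine dense_iInter_of_isOpen (fun k => ?_) fun k => ?_
    · exact isOpen_ne_fun (φ k).continuous_of_finiteDimensional continuous_const
    · have h : {z | φ k z ≠ 0} = (((φ k).ker : Set (Fin N → ℝ)))ᶜ := by
        ext z; simp
      rw [h, ← interior_eq_empty_iff_dense_compl, ← Set.not_nonempty_iff_eq_empty]
      intro hne
      exact k.2 (LinearMap.ker_eq_top.1 (Submodule.eq_top_of_nonempty_interior' _ hne))
  obtain ⟨z, hz, hzy⟩ := Metric.dense_iff.1 hd y ε hε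
  exact ⟨z, hz, fun k hk => Set.mem_iInter.1 hzy ⟨k, hk⟩⟩

/-- Near a family all of whose transversal hyperplanes avoid the remaining vectors, the parity is
constant. -/
lemma eventually_bisectorParity_eq [Fintype ι] (c : ι → Fin M) {y : ι → Fin (M + 1) → ℝ}
    (hy : ∀ σ : Fin M → ι, (∀ i, c (σ i) = i) → ∀ b, b ∉ Set.range σ → bracket y σ b ≠ 0) :
    ∀ᶠ x in 𝓝 y, bisectorParity c x = bisectorParity c y := by
  have hcont : ∀ (σ : Fin M → ι) (b : ι), Continuous fun x : ι → Fin (M + 1) → ℝ =>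
      bracket x σ b := by
    intro σ b
    refine Continuous.matrix_det (A := fun x : ι → Fin (M + 1) → ℝ =>
      x ∘ (Fin.cons b σ : Fin (M + 1) → ι)) ?_
    exact continuous_pi fun k => continuous_apply _
  have h : ∀ᶠ x in 𝓝 y, ∀ (σ : Fin M → ι) (b : ι), (∀ i, c (σ i) = i) →
      SignType.sign (bracket x σ b) = SignType.sign (bracket y σ b) := by
    refine eventually_all.2 fun σ => eventually_all.2 fun b => ?_
    by_cases hb : b ∈ Set.range σ
    · exact Eventually.of_forall fun x _ => by
        rw [bracket_eq_zero_of_mem_range _ _ hb, bracket_eq_zero_of_mem_range _ _ hb]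
    by_cases hσ : ∀ i, c (σ i) = i
    · filter_upwards [eventually_sign_eq (hcont σ b).continuousAt (hy σ hσ b hb)] with x hx _
      exact hx
    · exact Eventually.of_forall fun x h => absurd h hσ
  filter_upwards [h] with x hx
  refine Finset.sum_congr rfl fun σ hσ => ?_
  have : (fun b => (SignType.sign (bracket x σ b) : ℤ)) =
      fun b => (SignType.sign (bracket y σ b) : ℤ) :=
    funext fun b => congrArg _ (hx σ b (Finset.mem_filter.1 hσ).2)
  simp only [this]

lemma bisectorParity_update_eq [Fintype ι] (c : ι → Fin M) {x : ι → Fin (M + 1) → ℝ}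
    (hx : GeneralPosition x) {j : ι} {z : Fin (M + 1) → ℝ}
    (hz : GeneralPosition (Function.update x j z))
    (hu : ∀ s, ∀ f g : Fin (M + 1) → ι, Function.Injective f → Function.Injective g →
      Matrix.detRowAlternating (moveLine x j z s ∘ f) = 0 →
      Matrix.detRowAlternating (moveLine x j z s ∘ g) = 0 → Set.range f = Set.range g) :
    bisectorParity c (Function.update x j z) = bisectorParity c x := by
  choose q hq using exists_eventually_bisectorParity_eq (c := c) hx hu
  have hloc : IsLocallyConstant q := by
    refine (IsLocallyConstant.iff_eventually_eq q).2 fun s₀ => ?_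
    have h1 : ∀ᶠ s in 𝓝[≠] s₀, q s = q s₀ := by
      filter_upwards [(eventually_eventually_nhdsWithin.2 (hq s₀)), self_mem_nhdsWithin]
        with s hs hne
      have h2 : ∀ᶠ t in 𝓝[≠] s, bisectorParity c (moveLine x j z t) = q s₀ := by
        rw [isOpen_compl_singleton.nhdsWithin_eq hne] at hs
        exact nhdsWithin_le_nhds hs
      obtain ⟨t, ht1, ht2⟩ := (h2.and (hq s)).exists
      exact ht2.symm.trans ht1
    filter_upwards [eventually_nhdsWithin_iff.1 h1] with s hs
    by_cases h : s = s₀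
    · rw [h]
    · exact hs h
  have hval : ∀ s, GeneralPosition (moveLine x j z s) →
      bisectorParity c (moveLine x j z s) = q s := by
    intro s hs
    have hcont : Continuous fun t => moveLine x j z t :=
      continuous_const.update j (by fun_prop)
    have h1 := hcont.continuousAt.eventually (eventually_bisectorParity_eq c
      fun σ hσ b hb => hs _ (cons_injective_of_transversal hσ hb))
    obtain ⟨t, ht1, ht2⟩ := ((h1.filter_mono nhdsWithin_le_nhds).and (hq s)).exists
    exact ht1.symm.trans ht2
  have h0 := hval 0 (by rwa [moveLine_zero])
  have h1 := hval 1 (by rwa [moveLine_one])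
  rw [moveLine_zero] at h0
  rw [moveLine_one] at h1
  rw [h0, h1]
  exact hloc.apply_eq_of_isPreconnected isPreconnected_univ (Set.mem_univ _) (Set.mem_univ _)

lemma exists_update_near [Fintype ι] (c : ι → Fin M) {x : ι → Fin (M + 1) → ℝ}
    (hx : GeneralPosition x) (j : ι) (y : Fin (M + 1) → ℝ) {ε : ℝ} (hε : 0 < ε) :
    ∃ z, dist z y < ε ∧ GeneralPosition (Function.update x j z) ∧
      bisectorParity c (Function.update x j z) = bisectorParity c x := by
  let T := (Fin (M + 1) → ι) × Fin (M + 1)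
  let φ : T ⊕ T × T → (Fin (M + 1) → ℝ) →ₗ[ℝ] ℝ := Sum.elim (fun p => slotDet x p.1 p.2)
    (fun p => slotDet x p.1.1 p.1.2 (x j) • slotDet x p.2.1 p.2.2 -
      slotDet x p.2.1 p.2.2 (x j) • slotDet x p.1.1 p.1.2)
  obtain ⟨z, hzy, hz⟩ := exists_dist_lt_forall_apply_ne_zero φ y hε
  have hself : ∀ f : Fin (M + 1) → ι, Function.Injective f → ∀ k, slotDet x f k (x (f k)) ≠ 0 := by
    intro f hf k
    rw [slotDet_self]
    exact hx f hf
  have hGP : GeneralPosition (Function.update x j z) := by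
    intro f hf
    by_cases hj : j ∈ Set.range f
    · obtain ⟨k, rfl⟩ := hj
      rw [slotDet_apply_of_injective x hf]
      refine hz (Sum.inl (f, k)) fun h => hself f hf k ?_
      change slotDet x f k = 0 at h
      rw [h, LinearMap.zero_apply]
    · rw [Function.update_comp_eq_of_notMem_range _ _ hj]
      exact hx f hf
  refine ⟨z, hzy, hGP, bisectorParity_update_eq c hx hGP fun s f g hf hg h0 h1 => ?_⟩
  have hrange : ∀ f : Fin (M + 1) → ι, Function.Injective f →
      Matrix.detRowAlternating (moveLine x j z s ∘ f) = 0 → j ∈ Set.range f := by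
    intro f hf h
    by_contra hj
    rw [moveLine, Function.update_comp_eq_of_notMem_range _ _ hj] at h
    exact hx f hf h
  obtain ⟨k, hk⟩ := hrange f hf h0
  obtain ⟨l, hl⟩ := hrange g hg h1
  by_contra hne
  have hcard : ∃ e, f e ∉ Set.range g := by
    by_contra hcon
    push Not at hcon
    apply hne
    have hsub : Finset.univ.image f ⊆ Finset.univ.image g := by
      intro e he
      obtain ⟨i, -, rfl⟩ := Finset.mem_image.1 he
      obtain ⟨i', hi'⟩ := hcon i
      exact Finset.mem_image.2 ⟨i', Finset.mem_univ _, hi'⟩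
    have heq := Finset.eq_of_subset_of_card_le hsub (by
      rw [Finset.card_image_of_injective _ hf, Finset.card_image_of_injective _ hg])
    have := congrArg (fun s : Finset ι => (s : Set ι)) heq
    simpa using this
  obtain ⟨e, he⟩ := hcard
  have hek : e ≠ k := by
    rintro rfl
    exact he ⟨l, hl.trans hk.symm⟩
  have hfe : slotDet x f k (x (f e)) = 0 := by
    rw [slotDet_apply_apply]
    refine Matrix.detRowAlternating.map_eq_zero_of_eq _ (i := e) (j := k) ?_ hek
    simp [Function.update_of_ne hek]
  have hge : slotDet x g l (x (f e)) ≠ 0 := by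
    rw [slotDet_apply_apply]
    refine hx _ ?_
    intro p q hpq
    by_cases hp : p = l <;> by_cases hq : q = l
    · rw [hp, hq]
    · subst hp
      rw [Function.update_self, Function.update_of_ne hq] at hpq
      exact absurd ⟨q, hpq.symm⟩ he
    · subst hq
      rw [Function.update_self, Function.update_of_ne hp] at hpq
      exact absurd ⟨p, hpq⟩ he
    · rw [Function.update_of_ne hp, Function.update_of_ne hq] at hpq
      exact hg hpq
  have hfj : slotDet x f k (x j) ≠ 0 := hk ▸ hself f hf k
  have hψ := hz (Sum.inr ((f, k), (g, l))) (by
    intro h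
    have := LinearMap.congr_fun h (x (f e))
    simp [φ, hfe, hge, hfj] at this)
  have h0' : slotDet x f k (x j + s • (z - x j)) = 0 := by
    rw [← slotDet_apply_of_injective x hf, hk]; exact h0
  have h1' : slotDet x g l (x j + s • (z - x j)) = 0 := by
    rw [← slotDet_apply_of_injective x hg, hl]; exact h1
  simp only [map_add, map_smul, map_sub, smul_eq_mul] at h0' h1'
  simp only [φ, Sum.elim_inr, LinearMap.sub_apply, LinearMap.smul_apply, smul_eq_mul] at hψ
  have hs : s ≠ 0 := by
    rintro rfl
    exact hfj (by simpa using h0')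
  apply hψ
  apply mul_left_cancel₀ hs
  linear_combination slotDet x f k (x j) * h1' - slotDet x g l (x j) * h0'

lemma exists_near_bisectorParity_eq [Fintype ι] (c : ι → Fin M) {w : ι → Fin (M + 1) → ℝ}
    (hw : GeneralPosition w) (y : ι → Fin (M + 1) → ℝ) {ε : ℝ} (hε : 0 < ε) :
    ∃ x, dist x y < ε ∧ GeneralPosition x ∧ bisectorParity c x = bisectorParity c w := by
  have key : ∀ s : Finset ι, ∃ x, (∀ b ∈ s, dist (x b) (y b) < ε) ∧ GeneralPosition x ∧
      bisectorParity c x = bisectorParity c w := by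
    intro s
    induction s using Finset.induction_on with
    | empty => exact ⟨w, by simp, hw, rfl⟩
    | insert j s hj ih =>
      obtain ⟨x, hxy, hx, hpar⟩ := ih
      obtain ⟨z, hz, hGP, hz'⟩ := exists_update_near c hx j (y j) hε
      refine ⟨Function.update x j z, fun b hb => ?_, hGP, hz'.trans hpar⟩
      by_cases hbj : b = j
      · subst hbj; simpa using hz
      · rw [Function.update_of_ne hbj]
        exact hxy b (Finset.mem_of_mem_insert_of_ne hb hbj)
  obtain ⟨x, hxy, hx⟩ := key Finset.univ
  exact ⟨x, (dist_pi_lt_iff hε).2 fun b => hxy b (Finset.mem_univ b), hx⟩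

lemma exists_generalPosition (ι : Type*) [Finite ι] (M : ℕ) :
    ∃ w : ι → Fin (M + 1) → ℝ, GeneralPosition w := by
  obtain ⟨n, ⟨e⟩⟩ := Finite.exists_equiv_fin ι
  refine ⟨fun b k => ((e b : ℕ) : ℝ) ^ (k : ℕ), fun f hf => ?_⟩
  change (Matrix.vandermonde fun k => ((e (f k) : ℕ) : ℝ)).det ≠ 0
  refine Matrix.det_vandermonde_ne_zero_iff.2 fun k l hkl => ?_
  exact hf (e.injective (Fin.ext (by exact_mod_cast hkl)))

end Deformation

section Base

lemma exists_sum_sign_sub_eq_zero (F : Finset ℝ) (hF : Odd F.card) :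
    ∃ m ∈ F, ∑ b ∈ F, (SignType.sign (b - m) : ℤ) = 0 := by
  obtain ⟨k, hk⟩ := hF
  let e := F.orderEmbOfFin hk
  let mid : Fin (2 * k + 1) := ⟨k, by omega⟩
  refine ⟨e mid, F.orderEmbOfFin_mem hk mid, ?_⟩
  have hsum : ∑ b ∈ F, (SignType.sign (b - e mid) : ℤ) =
      ∑ l, (SignType.sign (e l - e mid) : ℤ) := by
    refine Eq.trans ?_ (Finset.sum_map Finset.univ e.toEmbedding
      fun b => (SignType.sign (b - e mid) : ℤ))
    congr 1
    ext b
    rw [← Finset.mem_coe, ← F.range_orderEmbOfFin hk]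
    simp [e]
  have hrev : ∑ l, (SignType.sign (e l - e mid) : ℤ) =
      -∑ l, (SignType.sign (e l - e mid) : ℤ) := by
    rw [← Finset.sum_neg_distrib, ← Equiv.sum_comp Fin.revPerm]
    refine Finset.sum_congr rfl fun l _ => ?_
    have hrevmid : Fin.rev mid = mid := by
      ext; simp [mid, Fin.val_rev]; omega
    rw [Fin.revPerm_apply]
    rcases lt_trichotomy l mid with h | h | h
    · have h' : mid < Fin.rev l := by rw [← Fin.rev_lt_rev, Fin.rev_rev, hrevmid]; exact h
      rw [sign_pos (sub_pos.2 (e.strictMono h')), sign_neg (sub_neg.2 (e.strictMono h))]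
      rfl
    · rw [h, hrevmid]; simp
    · have h' : Fin.rev l < mid := by rw [← Fin.rev_lt_rev, Fin.rev_rev, hrevmid]; exact h
      rw [sign_neg (sub_neg.2 (e.strictMono h')), sign_pos (sub_pos.2 (e.strictMono h))]
      rfl
  rw [hsum]
  omega

lemma sum_sign_sub_lt {ι : Type*} (F : Finset ι) (t : ι → ℝ) {m m' : ι} (hm : m ∈ F)
    (h : t m < t m') :
    ∑ b ∈ F, (SignType.sign (t b - t m') : ℤ) < ∑ b ∈ F, (SignType.sign (t b - t m) : ℤ) := by
  have hmono : ∀ r r' : ℝ, r ≤ r' → (SignType.sign r : ℤ) ≤ SignType.sign r' := by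
    intro r r' hr
    have := SignType.sign.monotone hr
    generalize SignType.sign r = u at *
    generalize SignType.sign r' = u' at *
    revert u u'
    decide
  refine Finset.sum_lt_sum (fun b _ => hmono _ _ (by linarith)) ⟨m, hm, ?_⟩
  rw [sign_neg (sub_neg.2 h), sub_self, sign_zero]
  decide

/-- A family whose transversal hyperplanes cut each class at one of its members, in the linear
order given by `t`. -/
noncomputable def staircase {ι : Type*} {M : ℕ} (c : ι → Fin M) (t : ι → ℝ) :
    ι → Fin (M + 1) → ℝ :=
  fun b => Fin.cons (t b) (Pi.single (c b) 1)

lemma bracket_staircase {ι : Type*} {M : ℕ} {c : ι → Fin M} (t : ι → ℝ) {σ : Fin M → ι}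
    (hσ : ∀ i, c (σ i) = i) (b : ι) :
    bracket (staircase c t) σ b = t b - t (σ (c b)) := by
  have hb : staircase c t b = staircase c t (σ (c b)) +
      (t b - t (σ (c b))) • (Fin.cons 1 0 : Fin (M + 1) → ℝ) := by
    ext k
    refine Fin.cases ?_ (fun i => ?_) k <;> simp [staircase, hσ]
  set f : Fin (M + 1) → ι := Fin.cons b σ with hf
  have h1 : slotDet (staircase c t) f 0 (staircase c t (σ (c b))) = 0 := by
    rw [slotDet_apply_apply]
    refine Matrix.detRowAlternating.map_eq_zero_of_eq _ (i := 0) (j := (c b).succ) ?_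
      (Fin.succ_ne_zero _).symm
    simp [hf]
  have h2 : slotDet (staircase c t) f 0 (Fin.cons 1 0) = 1 := by
    let B : Matrix (Fin (M + 1)) (Fin (M + 1)) ℝ :=
      Matrix.of (Function.update (staircase c t ∘ f) 0 (Fin.cons 1 0))
    have hB0 : B 0 = Fin.cons 1 0 := by
      change Function.update (staircase c t ∘ f) 0 (Fin.cons 1 0) 0 = _
      rw [Function.update_self]
    have hB : B.submatrix Fin.succ (Fin.succAbove 0) = 1 := by
      ext i l
      simp [B, hf, staircase, hσ, Matrix.one_apply, Pi.single_apply, eq_comm]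
    change B.det = 1
    rw [Matrix.det_succ_row_zero, Finset.sum_eq_single 0]
    · rw [hB0, hB]
      simp
    · intro l _ hl
      obtain ⟨i, rfl⟩ := Fin.exists_succ_eq.2 hl
      simp [hB0]
    · simp
  have h3 : bracket (staircase c t) σ b = slotDet (staircase c t) f 0 (staircase c t b) := by
    rw [slotDet_apply_apply]
    simp [hf, bracket]
  rw [h3, hb, map_add, map_smul, h1, h2]
  simp

lemma exists_bisectorParity_eq_one {ι : Type*} [Fintype ι] {M : ℕ} (c : ι → Fin M)
    (hc : ∀ i, Odd (Finset.univ.filter fun b => c b = i).card) :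
    ∃ y : ι → Fin (M + 1) → ℝ,
      (∀ σ : Fin M → ι, (∀ i, c (σ i) = i) → ∀ b, b ∉ Set.range σ → bracket y σ b ≠ 0) ∧
      bisectorParity c y = 1 := by
  let t : ι → ℝ := fun b => ((Fintype.equivFin ι b : ℕ) : ℝ)
  have ht : Function.Injective t := fun b b' h =>
    (Fintype.equivFin ι).injective (Fin.ext (Nat.cast_injective h))
  have hmed : ∀ i, ∃ m, c m = i ∧ ∑ b with c b = i, (SignType.sign (t b - t m) : ℤ) = 0 := by
    intro i
    obtain ⟨r, hr, hsum⟩ := exists_sum_sign_sub_eq_zero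
      ((Finset.univ.filter fun b => c b = i).image t)
      (by rw [Finset.card_image_of_injective _ ht]; exact hc i)
    obtain ⟨m, hm, rfl⟩ := Finset.mem_image.1 hr
    refine ⟨m, (Finset.mem_filter.1 hm).2, ?_⟩
    rwa [Finset.sum_image (fun _ _ _ _ h => ht h)] at hsum
  choose μ hμc hμ using hmed
  refine ⟨staircase c t, fun σ hσ b hb => ?_, ?_⟩
  · rw [bracket_staircase t hσ, sub_ne_zero]
    intro h
    exact hb ⟨c b, (ht h).symm⟩
  · have hsum : ∀ σ : Fin M → ι, (∀ i, c (σ i) = i) → ∀ i,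
        ∑ b with c b = i, (SignType.sign (bracket (staircase c t) σ b) : ℤ) =
          ∑ b with c b = i, (SignType.sign (t b - t (σ i)) : ℤ) := by
      intro σ hσ i
      refine Finset.sum_congr rfl fun b hb => ?_
      rw [bracket_staircase t hσ, (Finset.mem_filter.1 hb).2]
    rw [bisectorParity, parity, Finset.sum_eq_single μ]
    · exact if_pos fun i => (hsum μ hμc i).trans (hμ i)
    · intro σ hσ hne
      replace hσ := (Finset.mem_filter.1 hσ).2
      refine if_neg fun hbal => hne (funext fun i => ?_)
      have h := (hsum σ hσ i).symm.trans (hbal i)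
      rcases lt_trichotomy (t (σ i)) (t (μ i)) with hlt | heq | hlt
      · have := sum_sign_sub_lt (Finset.univ.filter fun b => c b = i) t
          (Finset.mem_filter.2 ⟨Finset.mem_univ _, hσ i⟩) hlt
        rw [h, hμ] at this
        exact absurd this (lt_irrefl _)
      · exact ht heq
      · have := sum_sign_sub_lt (Finset.univ.filter fun b => c b = i) t
          (Finset.mem_filter.2 ⟨Finset.mem_univ _, hμc i⟩) hlt
        rw [h, hμ] at this
        exact absurd this (lt_irrefl _)
    · intro h
      exact absurd (Finset.mem_filter.2 ⟨Finset.mem_univ _, hμc⟩) h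

end Base

section Bisection

open scoped Matrix

variable {ι : Type*} [Fintype ι] {M : ℕ}

/-- At most half of every colour class lies strictly on either side of the hyperplane with normal
vector `v`. -/
def Bisects (c : ι → Fin M) (x : ι → Fin (M + 1) → ℝ) (v : Fin (M + 1) → ℝ) : Prop :=
  ∀ i, 2 * (Finset.univ.filter fun b => c b = i ∧ 0 < v ⬝ᵥ x b).card ≤
      (Finset.univ.filter fun b => c b = i).card ∧
    2 * (Finset.univ.filter fun b => c b = i ∧ v ⬝ᵥ x b < 0).card ≤
      (Finset.univ.filter fun b => c b = i).card

lemma bisects_of_balanced {c : ι → Fin M} {x : ι → Fin (M + 1) → ℝ} {v : Fin (M + 1) → ℝ}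
    (h : Balanced c fun b => (SignType.sign (v ⬝ᵥ x b) : ℤ)) : Bisects c x v := by
  intro i
  have h1 : ∀ r : ℝ, (SignType.sign r : ℤ) =
      (if 0 < r then 1 else 0) - (if r < 0 then 1 else 0) := by
    intro r
    rcases lt_trichotomy r 0 with hr | rfl | hr
    · simp [hr, hr.not_gt]
    · simp
    · simp [hr, hr.not_gt]
  have h2 := h i
  simp only [h1, Finset.sum_sub_distrib, Finset.sum_boole, Finset.filter_filter] at h2
  have h3 : (Finset.univ.filter fun b => c b = i ∧ 0 < v ⬝ᵥ x b).card +
      (Finset.univ.filter fun b => c b = i ∧ v ⬝ᵥ x b < 0).card ≤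
        (Finset.univ.filter fun b => c b = i).card := by
    rw [← Finset.card_union_of_disjoint]
    · refine Finset.card_le_card fun b hb => ?_
      simp only [Finset.mem_union, Finset.mem_filter] at hb ⊢
      tauto
    · refine Finset.disjoint_left.2 fun b hb hb' => ?_
      exact lt_asymm (Finset.mem_filter.1 hb).2.2 (Finset.mem_filter.1 hb').2.2
  omega

lemma Bisects.smul {c : ι → Fin M} {x : ι → Fin (M + 1) → ℝ} {v : Fin (M + 1) → ℝ}
    (h : Bisects c x v) {r : ℝ} (hr : 0 < r) : Bisects c x (r • v) := by
  have hneg : ∀ y : ℝ, r * y < 0 ↔ y < 0 := fun y => smul_neg_iff_of_pos_left hr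
  simpa only [Bisects, smul_dotProduct, smul_eq_mul, mul_pos_iff_of_pos_left hr, hneg] using h

lemma exists_bisects_near {c : ι → Fin M} (hc : ∀ i, Odd (Finset.univ.filter fun b => c b = i).card)
    (hcard : M < Fintype.card ι) (a : ι → Fin (M + 1) → ℝ) {ε : ℝ} (hε : 0 < ε) :
    ∃ x, dist x a < ε ∧ ∃ v : Fin (M + 1) → ℝ, ‖v‖ = 1 ∧ Bisects c x v := by
  obtain ⟨w, hw⟩ := exists_generalPosition ι M
  obtain ⟨y, hy, hy1⟩ := exists_bisectorParity_eq_one c hc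
  obtain ⟨δ, hδ, hδy⟩ := Metric.eventually_nhds_iff.1 (eventually_bisectorParity_eq c hy)
  obtain ⟨x', hx'y, -, hx'w⟩ := exists_near_bisectorParity_eq c hw y hδ
  have hw1 : bisectorParity c w = 1 := by rw [← hx'w, hδy hx'y, hy1]
  obtain ⟨x, hxa, hx, hxw⟩ := exists_near_bisectorParity_eq c hw a hε
  rw [hw1] at hxw
  have hne : ∃ σ : Fin M → ι, (∀ i, c (σ i) = i) ∧
      Balanced c fun b => (SignType.sign (bracket x σ b) : ℤ) := by
    by_contra hcon
    push Not at hcon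
    rw [bisectorParity, parity, Finset.sum_eq_zero] at hxw
    · exact zero_ne_one hxw
    · intro σ hσ
      exact if_neg (hcon σ (Finset.mem_filter.1 hσ).2)
  obtain ⟨σ, hσ, hbal⟩ := hne
  obtain ⟨b, hb⟩ : ∃ b, b ∉ Set.range σ := by
    by_contra hcon
    push Not at hcon
    have := Fintype.card_le_of_surjective σ hcon
    rw [Fintype.card_fin] at this
    omega
  let f : Fin (M + 1) → ι := Fin.cons b σ
  let v : Fin (M + 1) → ℝ := fun k => slotDet x f 0 fun l => if k = l then 1 else 0
  have hv : ∀ e, v ⬝ᵥ x e = bracket x σ e := by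
    intro e
    have h1 : bracket x σ e = slotDet x f 0 (x e) := by
      rw [slotDet_apply_apply]
      simp [f, bracket]
    rw [h1, LinearMap.pi_apply_eq_sum_univ, dotProduct]
    exact Finset.sum_congr rfl fun k _ => mul_comm _ _
  have hv0 : v ≠ 0 := by
    intro h
    refine hx _ (cons_injective_of_transversal hσ hb) ?_
    change bracket x σ b = 0
    rw [← hv, h, zero_dotProduct]
  have hbis : Bisects c x v := bisects_of_balanced (by simpa only [hv] using hbal)
  exact ⟨x, hxa, ‖v‖⁻¹ • v, norm_smul_inv_norm hv0,
    hbis.smul (inv_pos.2 (norm_pos_iff.2 hv0))⟩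

/-- **Discrete ham sandwich theorem**, for `M` classes of odd size in a space of dimension
`M + 1` and linear hyperplanes. -/
theorem exists_bisects {c : ι → Fin M}
    (hc : ∀ i, Odd (Finset.univ.filter fun b => c b = i).card) (a : ι → Fin (M + 1) → ℝ) :
    ∃ v : Fin (M + 1) → ℝ, v ≠ 0 ∧ Bisects c a v := by
  rcases le_or_gt (Fintype.card ι) M with hcard | hcard
  · let L : (Fin (M + 1) → ℝ) →ₗ[ℝ] (ι → ℝ) := Matrix.mulVecLin (Matrix.of a)
    have hker : L.ker ≠ ⊥ := LinearMap.ker_ne_bot_of_finrank_lt (by simp; omega)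
    obtain ⟨v, hv, hv0⟩ := Submodule.exists_mem_ne_zero_of_ne_bot hker
    have hva : ∀ b, v ⬝ᵥ a b = 0 := by
      intro b
      rw [dotProduct_comm]
      exact congrFun (LinearMap.mem_ker.1 hv) b
    exact ⟨v, hv0, fun i => by simp [hva]⟩
  choose x hxa v hv hbis using fun n : ℕ =>
    exists_bisects_near hc hcard a (ε := 1 / ((n : ℝ) + 1)) (by positivity)
  have hx : Tendsto x atTop (𝓝 a) := by
    rw [tendsto_iff_dist_tendsto_zero]
    exact squeeze_zero (fun n => dist_nonneg) (fun n => (hxa n).le)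
      tendsto_one_div_add_atTop_nhds_zero_nat
  obtain ⟨u, hu, φ, hφ, hlim⟩ := (isCompact_sphere (0 : Fin (M + 1) → ℝ) 1).tendsto_subseq
    (x := v) fun n => by simpa using hv n
  have hu0 : u ≠ 0 := by
    rintro rfl
    simp at hu
  have hdot : ∀ b, Tendsto (fun n => v (φ n) ⬝ᵥ x (φ n) b) atTop (𝓝 (u ⬝ᵥ a b)) := by
    intro b
    have h1 : Tendsto (fun n => x (φ n) b) atTop (𝓝 (a b)) :=
      (tendsto_pi_nhds.1 hx b).comp hφ.tendsto_atTop
    exact tendsto_finsetSum _ fun k _ =>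
      (tendsto_pi_nhds.1 hlim k).mul (tendsto_pi_nhds.1 h1 k)
  have hev : ∀ᶠ n in atTop, ∀ b, (0 < u ⬝ᵥ a b → 0 < v (φ n) ⬝ᵥ x (φ n) b) ∧
      (u ⬝ᵥ a b < 0 → v (φ n) ⬝ᵥ x (φ n) b < 0) := by
    refine eventually_all.2 fun b => Eventually.and ?_ ?_
    · by_cases h : 0 < u ⬝ᵥ a b
      · filter_upwards [(hdot b).eventually_const_lt h] with n hn _ using hn
      · exact Eventually.of_forall fun n h' => absurd h' h
    · by_cases h : u ⬝ᵥ a b < 0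
      · filter_upwards [(hdot b).eventually_lt_const h] with n hn _ using hn
      · exact Eventually.of_forall fun n h' => absurd h' h
  obtain ⟨n, hn⟩ := hev.exists
  refine ⟨u, hu0, fun i => ⟨?_, ?_⟩⟩
  · refine le_trans (Nat.mul_le_mul_left 2 (Finset.card_le_card fun b hb => ?_)) (hbis (φ n) i).1
    simp only [Finset.mem_filter] at hb ⊢
    exact ⟨hb.1, hb.2.1, (hn b).1 hb.2.2⟩
  · refine le_trans (Nat.mul_le_mul_left 2 (Finset.card_le_card fun b hb => ?_)) (hbis (φ n) i).2
    simp only [Finset.mem_filter] at hb ⊢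
    exact ⟨hb.1, hb.2.1, (hn b).2 hb.2.2⟩

end Bisection

lemma exists_odd_card_of_half {α : Type*} (a : α) (S : Finset α) :
    ∃ T : Finset α, Odd T.card ∧ ∀ P : α → Prop,
      2 * (T.filter P).card ≤ T.card → 2 * (S.filter P).card ≤ S.card := by
  rcases Nat.even_or_odd S.card with hS | hS
  · rcases S.eq_empty_or_nonempty with rfl | ⟨x, hx⟩
    · exact ⟨{a}, by simp, by simp⟩
    · have hcard := Finset.card_erase_add_one hx
      refine ⟨S.erase x, ?_, fun P hP => ?_⟩
      · rw [← hcard, Nat.even_add_one, Nat.not_even_iff_odd] at hS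
        exact hS
      · have h1 : (S.filter P).card ≤ ((S.erase x).filter P).card + 1 := by
          rw [Finset.filter_erase]
          have := Finset.pred_card_le_card_erase (s := S.filter P) (a := x)
          omega
        rw [← hcard] at hS ⊢
        obtain ⟨k, hk⟩ := hS
        omega
  · exact ⟨S, hS, fun P hP => hP⟩

lemma exists_injective_exponents (n d : ℕ) :
    ∃ e : Fin ((d + n).choose n - 1 + 1) → (Fin n →₀ ℕ), Function.Injective e ∧
      ∀ k, (e k).degree ≤ d := by
  let A : Finset (Fin (n + 1) →₀ ℕ) := Finset.univ.finsuppAntidiag d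
  have hA : A.card = (d + n).choose n - 1 + 1 := by
    have hpos : 0 < (d + n).choose n := Nat.choose_pos (Nat.le_add_left n d)
    rw [Finset.card_finsuppAntidiag_nat_eq_choose, Finset.card_univ, Fintype.card_fin,
      Nat.sub_add_cancel hpos, Nat.add_right_comm, Nat.add_sub_cancel, Nat.add_comm n d,
      Nat.choose_symm_add]
  have hsum : ∀ t ∈ A, t 0 + (Finsupp.tail t).degree = d := by
    intro t ht
    rw [← (Finset.mem_finsuppAntidiag.1 ht).1, Fin.sum_univ_succ, Finsupp.degree_eq_sum]
    simp only [Finsupp.tail_apply]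
  let E := (A.equivFinOfCardEq hA).symm
  refine ⟨fun k => Finsupp.tail (E k).1, fun k l hkl => E.injective (Subtype.ext ?_), fun k => ?_⟩
  · have hk := hsum _ (E k).2
    have hl := hsum _ (E l).2
    simp only at hkl
    rw [← Finsupp.cons_tail (E k).1, ← Finsupp.cons_tail (E l).1, hkl]
    rw [hkl] at hk
    congr 1
    omega
  · have hk := hsum _ (E k).2
    simp only
    omega

lemma card_filter_sigma_fst {κ α : Type*} [Fintype κ] (T : κ → Finset α) (P : α → Prop) (i : κ) :
    (Finset.univ.filter fun b : Σ j, {x // x ∈ T j} => b.1 = i ∧ P b.2).card =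
      ((T i).filter P).card := by
  refine Finset.card_bij (fun b _ => b.2) ?_ ?_ ?_
  · rintro ⟨j, x, hx⟩ hb
    obtain ⟨-, rfl, hP⟩ := Finset.mem_filter.1 hb
    exact Finset.mem_filter.2 ⟨hx, hP⟩
  · rintro ⟨j, x, hx⟩ hb ⟨k, y, hy⟩ hb' h
    obtain ⟨-, rfl, -⟩ := Finset.mem_filter.1 hb
    obtain ⟨-, rfl, -⟩ := Finset.mem_filter.1 hb'
    obtain rfl : x = y := h
    rfl
  · intro x hx
    obtain ⟨hx, hP⟩ := Finset.mem_filter.1 hx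
    exact ⟨⟨i, x, hx⟩, Finset.mem_filter.2 ⟨Finset.mem_univ _, rfl, hP⟩, rfl⟩

end HamSandwich

theorem stmt2 (n d : ℕ) (hd : 0 < d)
    (S : Fin ((d + n).choose n - 1) → Finset (Fin n → ℝ))
    (hdisj : ∀ i j, i ≠ j → Disjoint (S i) (S j)) :
    ∃ p : MvPolynomial (Fin n) ℝ, p ≠ 0 ∧ p.totalDegree ≤ d ∧
      ∀ i,
        2 * ((S i).filter (fun x => 0 < MvPolynomial.eval x p)).card ≤ (S i).card ∧
        2 * ((S i).filter (fun x => MvPolynomial.eval x p < 0)).card ≤ (S i).card := by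
  obtain ⟨e, he, hed⟩ := HamSandwich.exists_injective_exponents n d
  choose T hT hTS using fun i => HamSandwich.exists_odd_card_of_half 0 (S i)
  have hcard : ∀ i, (Finset.univ.filter fun b : Σ i, {x // x ∈ T i} => b.1 = i).card =
      (T i).card := fun i => by
    simpa using HamSandwich.card_filter_sigma_fst T (fun _ => True) i
  obtain ⟨v, hv, hbis⟩ := HamSandwich.exists_bisects
    (c := fun b : Σ i, {x // x ∈ T i} => b.1) (fun i => (hcard i).symm ▸ hT i)
    (fun b k => (e k).prod fun l m => b.2.1 l ^ m)
  let p : MvPolynomial (Fin n) ℝ := ∑ k, MvPolynomial.monomial (e k) (v k)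
  have heval : ∀ x : Fin n → ℝ,
      MvPolynomial.eval x p = v ⬝ᵥ fun k => (e k).prod fun l m => x l ^ m := by
    intro x
    simp only [p, map_sum, MvPolynomial.eval_monomial]
    rfl
  have hcoeff : ∀ k, p.coeff (e k) = v k := by
    intro k
    simp only [p, MvPolynomial.coeff_sum, MvPolynomial.coeff_monomial, he.eq_iff]
    simp
  refine ⟨p, fun hp => hv (funext fun k => ?_), ?_, fun i => ⟨hTS i _ ?_, hTS i _ ?_⟩⟩
  · rw [← hcoeff k, hp, MvPolynomial.coeff_zero, Pi.zero_apply]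
  · refine MvPolynomial.totalDegree_finsetSum_le fun k _ => ?_
    exact (MvPolynomial.totalDegree_monomial_le _ _).trans (hed k)
  · rw [← hcard, ← HamSandwich.card_filter_sigma_fst T _ i]
    simpa only [heval] using (hbis i).1
  · rw [← hcard, ← HamSandwich.card_filter_sigma_fst T _ i]
    simpa only [heval] using (hbis i).2
end

section
/- Let p in R[x,y,z] be a nonzero square-free polynomial of degree at most d with zero set Z. Then Z contains at most d^2 critical lines, where a critical line is a line all of whose points x satisfy p(x) = 0 and ∇p(x) = 0. -/
/-- The line in `ℝ³` through `v` with direction `b`. -/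
def lineSet (v b : Fin 3 → ℝ) : Set (Fin 3 → ℝ) := {x | ∃ t : ℝ, x = v + t • b}

/-- The set of critical lines of the zero set of `p`: lines all of whose points `x`
satisfy `p x = 0` and `∇p x = 0`. -/
def criticalLines (p : MvPolynomial (Fin 3) ℝ) : Set (Set (Fin 3 → ℝ)) :=
  {l | ∃ v b : Fin 3 → ℝ, b ≠ 0 ∧ l = lineSet v b ∧
    ∀ x ∈ l, MvPolynomial.eval x p = 0 ∧
      ∀ i : Fin 3, MvPolynomial.eval x (MvPolynomial.pderiv i p) = 0}

open Polynomial

theorem squarefree_map_fractionRing {A : Type*} [CommRing A] [IsDomain A]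
    [UniqueFactorizationMonoid A] {P : A[X]} (hP : Squarefree P) :
    Squarefree (P.map (algebraMap A (FractionRing A))) := by
  classical
  have := Classical.arbitrary (NormalizedGCDMonoid A)
  have hP0 : P.map (algebraMap A (FractionRing A)) ≠ 0 :=
    (Polynomial.map_ne_zero_iff (IsFractionRing.injective A (FractionRing A))).2 hP.ne_zero
  intro x hx
  have hx0 : x ≠ 0 := by
    rintro rfl
    exact hP0 (by simpa using hx)
  set q := IsLocalization.integerNormalization (nonZeroDivisors A) x with hq
  refine isUnit_or_eq_zero_of_isUnit_integerNormalization_primPart hx0 (hP _ ?_)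
  refine (q.isPrimitive_primPart.mul q.isPrimitive_primPart).dvd_of_fraction_map_dvd_fraction_map
    (K := FractionRing A) (dvd_trans ?_ hx)
  have hqx : q.primPart.map (algebraMap A (FractionRing A)) ∣ x := by
    obtain ⟨c, c0, hc⟩ := IsLocalization.integerNormalization_spec (nonZeroDivisors A) x
    rw [Algebra.smul_def, Polynomial.algebraMap_apply] at hc
    have hu : IsUnit (C (algebraMap A (FractionRing A) c)) := by
      rw [isUnit_C, isUnit_iff_ne_zero]
      exact IsFractionRing.to_map_ne_zero_of_mem_nonZeroDivisors c0
    refine dvd_trans ?_ (hu.dvd_mul_left.1 hc.dvd)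
    exact Polynomial.map_dvd _ q.primPart_dvd
  rw [Polynomial.map_mul]
  exact mul_dvd_mul hqx hqx

theorem resultant_derivative_ne_zero {A : Type*} [CommRing A] [IsDomain A] [CharZero A]
    [UniqueFactorizationMonoid A] {P : A[X]} (hP : Squarefree P) :
    P.resultant P.derivative ≠ 0 := by
  have hinj := IsFractionRing.injective A (FractionRing A)
  have : CharZero (FractionRing A) := charZero_of_injective_algebraMap hinj
  have hsep := PerfectField.separable_iff_squarefree.2 (squarefree_map_fractionRing hP)
  have h := resultant_ne_zero _ _ hsep
  rw [Polynomial.derivative_map, natDegree_map_eq_of_injective hinj,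
    natDegree_map_eq_of_injective hinj, resultant_map_map] at h
  exact fun h0 => h (by rw [h0, map_zero])

theorem natDegree_det_add_le {A ι : Type*} [CommRing A] [Fintype ι] [DecidableEq ι]
    (M : Matrix ι ι A[X]) (r c : ι → ℕ)
    (h : ∀ i j, M i j ≠ 0 → (M i j).natDegree + r i ≤ c j) (h0 : M.det ≠ 0) :
    M.det.natDegree + ∑ i, r i ≤ ∑ j, c j := by
  have key : ∀ σ : Equiv.Perm ι, ∏ i, M (σ i) i ≠ 0 →
      (∏ i, M (σ i) i).natDegree + ∑ i, r i ≤ ∑ j, c j := by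
    intro σ hσ
    have hne : ∀ i, M (σ i) i ≠ 0 := fun i hi => hσ (Finset.prod_eq_zero (Finset.mem_univ i) hi)
    calc (∏ i, M (σ i) i).natDegree + ∑ i, r i
        ≤ ∑ i, (M (σ i) i).natDegree + ∑ i, r (σ i) := by
          rw [Equiv.sum_comp σ r]
          gcongr
          exact natDegree_prod_le _ _
      _ = ∑ i, ((M (σ i) i).natDegree + r (σ i)) := Finset.sum_add_distrib.symm
      _ ≤ ∑ j, c j := Finset.sum_le_sum fun i _ => h _ _ (hne i)
  have hex : ∑ i, r i ≤ ∑ j, c j := by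
    by_contra hlt
    refine h0 ?_
    rw [Matrix.det_apply]
    refine Finset.sum_eq_zero fun σ _ => ?_
    by_cases hσ : ∏ i, M (σ i) i = 0
    · rw [hσ, smul_zero]
    · exact absurd ((Nat.le_add_left _ _).trans (key σ hσ)) hlt
  have : M.det.natDegree ≤ ∑ j, c j - ∑ i, r i := by
    rw [Matrix.det_apply]
    refine natDegree_sum_le_of_forall_le _ _ fun σ _ => ?_
    by_cases hσ : ∏ i, M (σ i) i = 0
    · simp [hσ]
    · refine (natDegree_smul_le _ _).trans ?_
      have := key σ hσ
      omega
  omega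

/-- `f`, seen as a polynomial in two variables over `A`, has total degree at most `n`. -/
def TotalDegreeLE {A : Type*} [CommRing A] (n : ℕ) (f : A[X][X]) : Prop :=
  ∀ k j, n < k + j → (f.coeff k).coeff j = 0

theorem TotalDegreeLE.add_natDegree_coeff_le {A : Type*} [CommRing A] {n : ℕ} {f : A[X][X]}
    (hf : TotalDegreeLE n f) {k : ℕ} (hk : f.coeff k ≠ 0) :
    (f.coeff k).natDegree + k ≤ n := by
  by_contra! h
  exact hk (leadingCoeff_eq_zero.1 (hf k _ (by omega)))

theorem TotalDegreeLE.mul {A : Type*} [CommRing A] {m n : ℕ} {f g : A[X][X]}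
    (hf : TotalDegreeLE m f) (hg : TotalDegreeLE n g) : TotalDegreeLE (m + n) (f * g) := by
  intro k j h
  rw [coeff_mul, finsetSum_coeff]
  refine Finset.sum_eq_zero fun x hx => ?_
  rw [coeff_mul]
  refine Finset.sum_eq_zero fun y hy => ?_
  rw [Finset.HasAntidiagonal.mem_antidiagonal] at hx hy
  by_cases hm : m < x.1 + y.1
  · rw [hf _ _ hm, zero_mul]
  · rw [hg _ _ (by omega), mul_zero]

theorem TotalDegreeLE.derivative {A : Type*} [CommRing A] {n : ℕ} {f : A[X][X]}
    (hf : TotalDegreeLE n f) : TotalDegreeLE n (derivative f) := by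
  intro k j h
  rw [coeff_derivative]
  have : ((k : A[X]) + 1) = C ((k : A) + 1) := by simp
  rw [this, coeff_mul_C, hf _ _ (by omega), zero_mul]

theorem TotalDegreeLE.mono {A : Type*} [CommRing A] {m n : ℕ} {f : A[X][X]}
    (hf : TotalDegreeLE m f) (h : m ≤ n) : TotalDegreeLE n f :=
  fun _ _ hk => hf _ _ (by omega)

theorem TotalDegreeLE.natDegree_resultant_add_le {A : Type*} [CommRing A] {n k l : ℕ}
    {f g : A[X][X]} (hf : TotalDegreeLE n f) (hg : TotalDegreeLE n g)
    (h0 : f.resultant g k l ≠ 0) :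
    (f.resultant g k l).natDegree + k * l ≤ (k + l) * n := by
  have key := natDegree_det_add_le (f.sylvester g k l) (fun i => (i : ℕ))
    (fun j => n + j.addCases (fun j₁ : Fin k => (j₁ : ℕ)) (fun j₁ : Fin l => (j₁ : ℕ))) ?_ h0
  · have hc : ∑ j : Fin (k + l),
        j.addCases (fun j₁ : Fin k => (j₁ : ℕ)) (fun j₁ : Fin l => (j₁ : ℕ)) =
        ∑ j : Fin k, (j : ℕ) + ∑ j : Fin l, (j : ℕ) := by
      rw [Fin.sum_univ_add]
      simp
    rw [Finset.sum_add_distrib, hc, Fin.sum_univ_add] at key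
    simp only [Fin.val_castAdd, Fin.val_natAdd, Finset.sum_add_distrib, Finset.sum_const,
      Finset.card_univ, Fintype.card_fin, smul_eq_mul] at key
    change (f.resultant g k l).natDegree + _ ≤ _ at key
    rw [mul_comm k l]
    omega
  · intro i j
    induction j using Fin.addCases with
    | left j =>
      intro h
      simp only [sylvester, Matrix.of_apply, Fin.addCases_left, Set.mem_Icc] at h ⊢
      split_ifs at h ⊢ with hc
      · have := hg.add_natDegree_coeff_le h
        omega
      · exact absurd rfl h
    | right j =>
      intro h
      simp only [sylvester, Matrix.of_apply, Fin.addCases_right, Set.mem_Icc] at h ⊢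
      split_ifs at h ⊢ with hc
      · have := hf.add_natDegree_coeff_le h
        omega
      · exact absurd rfl h

theorem TotalDegreeLE.exists_eliminant {A : Type*} [CommRing A] [IsDomain A] [CharZero A]
    [UniqueFactorizationMonoid A] {n : ℕ} {P : A[X][X]} (hP : Squarefree P)
    (hn : TotalDegreeLE n P) :
    ∃ R : A[X], R ≠ 0 ∧ R.natDegree ≤ n ^ 2 ∧
      ∃ a b, P * a + Polynomial.derivative P * b = C R := by
  rcases Nat.eq_zero_or_pos P.natDegree with h0 | hpos
  · rw [natDegree_eq_zero] at h0
    obtain ⟨R, rfl⟩ := h0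
    have hR : R ≠ 0 := by
      rintro rfl
      exact hP.ne_zero (map_zero C)
    refine ⟨R, hR, ?_, 1, 0, by simp⟩
    have := hn.add_natDegree_coeff_le (k := 0) (by simpa using hR)
    rw [coeff_C_zero] at this
    nlinarith
  · have hR := resultant_derivative_ne_zero hP
    refine ⟨_, hR, ?_, ?_⟩
    · have h1 := hn.natDegree_resultant_add_le hn.derivative hR
      have h2 := hn.add_natDegree_coeff_le (k := P.natDegree)
        (leadingCoeff_ne_zero.2 hP.ne_zero)
      rw [natDegree_derivative] at h1
      obtain ⟨k, hk⟩ : ∃ k, P.natDegree = k + 1 := ⟨P.natDegree - 1, by omega⟩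
      obtain ⟨e, he⟩ : ∃ e, n = k + 1 + e := ⟨n - (k + 1), by omega⟩
      rw [natDegree_derivative, hk, Nat.add_sub_cancel]
      rw [hk, Nat.add_sub_cancel] at h1
      subst he
      nlinarith
    · obtain ⟨a, b, -, -, hab⟩ := exists_mul_add_mul_eq_C_resultant P (Polynomial.derivative P)
        (m := P.natDegree) (n := (Polynomial.derivative P).natDegree) le_rfl le_rfl
        (Or.inl hpos.ne')
      exact ⟨a, b, hab⟩

theorem TotalDegreeLE.C_C {A : Type*} [CommRing A] (n : ℕ) (a : A) :
    TotalDegreeLE n (C (C a)) := by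
  intro k j h
  rcases Nat.eq_zero_or_pos k with rfl | hk
  · rw [coeff_C_zero, coeff_C_of_ne_zero (by omega)]
  · rw [coeff_C_of_ne_zero (by omega), coeff_zero]

theorem TotalDegreeLE.sum {A ι : Type*} [CommRing A] {n : ℕ} {s : Finset ι} {f : ι → A[X][X]}
    (hf : ∀ i ∈ s, TotalDegreeLE n (f i)) : TotalDegreeLE n (∑ i ∈ s, f i) := by
  intro k j h
  rw [finsetSum_coeff, finsetSum_coeff]
  exact Finset.sum_eq_zero fun i hi => hf i hi k j h

theorem TotalDegreeLE.pow {A : Type*} [CommRing A] {f : A[X][X]} (hf : TotalDegreeLE 1 f)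
    (n : ℕ) : TotalDegreeLE n (f ^ n) := by
  induction n with
  | zero => simpa using TotalDegreeLE.C_C 0 (1 : A)
  | succ n ih => exact pow_succ f n ▸ ih.mul hf

theorem TotalDegreeLE.prod {A ι : Type*} [CommRing A] {s : Finset ι} {n : ι → ℕ}
    {f : ι → A[X][X]} (hf : ∀ i ∈ s, TotalDegreeLE (n i) (f i)) :
    TotalDegreeLE (∑ i ∈ s, n i) (∏ i ∈ s, f i) := by
  classical
  induction s using Finset.induction_on with
  | empty => simpa using TotalDegreeLE.C_C 0 (1 : A)
  | insert i s hi ih =>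
    rw [Finset.sum_insert hi, Finset.prod_insert hi]
    exact (hf i (Finset.mem_insert_self i s)).mul
      (ih fun j hj => hf j (Finset.mem_insert_of_mem hj))

theorem TotalDegreeLE.aeval {A σ : Type*} [CommRing A] [Algebra ℝ A] {f : σ → A[X][X]}
    (hf : ∀ i, TotalDegreeLE 1 (f i)) (p : MvPolynomial σ ℝ) :
    TotalDegreeLE p.totalDegree (MvPolynomial.aeval f p) := by
  rw [MvPolynomial.aeval_def, MvPolynomial.eval₂_eq]
  refine TotalDegreeLE.sum fun d hd => ?_
  refine ((TotalDegreeLE.C_C 0 (algebraMap ℝ A (p.coeff d))).mul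
    (TotalDegreeLE.prod fun i _ => (hf i).pow (d i))).mono ?_
  rw [zero_add]
  exact MvPolynomial.le_totalDegree hd

/-- The three variables of the iterated polynomial ring `ℝ[y][z][x]`, in the order `x, y, z`. -/
noncomputable def iteratedVar : Fin 3 → ℝ[X][X][X] := ![X, C (C X), C X]

/-- Evaluation of an element of `ℝ[y][z][x]` at a triple `(x, y, z)` of a commutative algebra. -/
noncomputable def iteratedAeval {B : Type*} [CommRing B] [Algebra ℝ B] (t : Fin 3 → B) :
    ℝ[X][X][X] →ₐ[ℝ] B :=
  aevalTower (aevalTower (Polynomial.aeval (t 1)) (t 2)) (t 0)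

theorem iteratedAeval_iteratedVar {B : Type*} [CommRing B] [Algebra ℝ B] (t : Fin 3 → B)
    (i : Fin 3) : iteratedAeval t (iteratedVar i) = t i := by
  fin_cases i <;> simp [iteratedAeval, iteratedVar]

/-- Linear change of coordinates `X j ↦ ∑ i, N j i • (x, y, z) i` from `ℝ[X₀, X₁, X₂]` to
`ℝ[y][z][x]`. -/
noncomputable def linearSubst (N : Matrix (Fin 3) (Fin 3) ℝ) :
    MvPolynomial (Fin 3) ℝ →ₐ[ℝ] ℝ[X][X][X] :=
  MvPolynomial.aeval fun j => ∑ i, N j i • iteratedVar i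

theorem iteratedAeval_linearSubst {B : Type*} [CommRing B] [Algebra ℝ B]
    (N : Matrix (Fin 3) (Fin 3) ℝ) (t : Fin 3 → B) (p : MvPolynomial (Fin 3) ℝ) :
    iteratedAeval t (linearSubst N p) = MvPolynomial.aeval (fun j => ∑ i, N j i • t i) p := by
  rw [← AlgHom.comp_apply]
  congr 1
  ext j
  simp [linearSubst, iteratedAeval_iteratedVar]

theorem sum_smul_sum_smul_of_mul_eq_one {ι K V : Type*} [Fintype ι] [DecidableEq ι]
    [CommSemiring K] [AddCommMonoid V] [Module K V] {M N : Matrix ι ι K} (h : N * M = 1)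
    (f : ι → V) (j : ι) : ∑ i, N j i • ∑ k, M i k • f k = f j := by
  simp_rw [Finset.smul_sum, smul_smul]
  rw [Finset.sum_comm]
  simp_rw [← Finset.sum_smul, ← Matrix.mul_apply, h, Matrix.one_apply, ite_smul, one_smul,
    zero_smul]
  simp

theorem squarefree_linearSubst {M N : Matrix (Fin 3) (Fin 3) ℝ} (hMN : M * N = 1)
    {p : MvPolynomial (Fin 3) ℝ} (hp : Squarefree p) : Squarefree (linearSubst N p) := by
  have hNM : N * M = 1 := mul_eq_one_comm.1 hMN
  have h1 : ∀ q, iteratedAeval (fun i => ∑ j, M i j • MvPolynomial.X j) (linearSubst N q) = q := by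
    intro q
    rw [iteratedAeval_linearSubst]
    simp_rw [sum_smul_sum_smul_of_mul_eq_one hNM]
    exact MvPolynomial.aeval_X_left_apply q
  have h2 : ∀ Q, linearSubst N (iteratedAeval (fun i => ∑ j, M i j • MvPolynomial.X j) Q) = Q := by
    have hvar : ∀ i, linearSubst N (∑ j, M i j • MvPolynomial.X j) = iteratedVar i := by
      intro i
      simp_rw [map_sum, map_smul, linearSubst, MvPolynomial.aeval_X]
      exact sum_smul_sum_smul_of_mul_eq_one hMN iteratedVar i
    intro Q
    change ((linearSubst N).comp (iteratedAeval fun i => ∑ j, M i j • MvPolynomial.X j)) Q =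
      AlgHom.id ℝ _ Q
    congr 1
    refine algHom_ext' (algHom_ext' (algHom_ext ?_) ?_) ?_
    · simpa [iteratedAeval, iteratedVar] using hvar 1
    · simpa [iteratedAeval, iteratedVar] using hvar 2
    · simpa [iteratedAeval, iteratedVar] using hvar 0
  intro x hx
  have := map_dvd
    (iteratedAeval (fun i => ∑ j, M i j • (MvPolynomial.X j : MvPolynomial (Fin 3) ℝ))) hx
  rw [h1, map_mul] at this
  have := (hp _ this).map (linearSubst N)
  rwa [h2] at this

theorem totalDegreeLE_linearSubst (N : Matrix (Fin 3) (Fin 3) ℝ) (p : MvPolynomial (Fin 3) ℝ) :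
    TotalDegreeLE p.totalDegree (linearSubst N p) := by
  refine TotalDegreeLE.aeval (fun j => TotalDegreeLE.sum fun i _ => ?_) p
  intro k l h
  have : ((iteratedVar i).coeff k).coeff l = 0 := by
    fin_cases i
    · suffices ((X : ℝ[X][X][X]).coeff k).coeff l = 0 from this
      rw [coeff_X]
      split_ifs with hk
      · rw [coeff_one, if_neg (by omega)]
      · rw [coeff_zero]
    · exact TotalDegreeLE.C_C 1 X k l h
    · suffices ((C X : ℝ[X][X][X]).coeff k).coeff l = 0 from this
      rw [coeff_C]
      split_ifs with hk
      · rw [coeff_X, if_neg (by omega)]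
      · rw [coeff_zero]
  rw [coeff_smul, coeff_smul, this, smul_zero]

theorem derivative_aeval_eq_sum {R A σ : Type*} [CommRing R] [CommRing A] [Algebra R A] [Fintype σ]
    (f : σ → A[X]) (p : MvPolynomial σ R) :
    derivative (MvPolynomial.aeval f p) =
      ∑ j, derivative (f j) * MvPolynomial.aeval f (MvPolynomial.pderiv j p) := by
  classical
  induction p using MvPolynomial.induction_on with
  | C a => simp [IsScalarTower.algebraMap_apply R A A[X]]
  | add p q hp hq => simp only [map_add, hp, hq, mul_add, Finset.sum_add_distrib]
  | mul_X p i hp =>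
    have hsum : ∑ j, derivative (f j) * (MvPolynomial.aeval f p *
        MvPolynomial.aeval f ((Pi.single j 1 : σ → MvPolynomial σ R) i)) =
        derivative (f i) * MvPolynomial.aeval f p := by
      rw [Finset.sum_eq_single i (fun j _ hj => by simp [Pi.single_eq_of_ne hj.symm]) (by simp),
        Pi.single_eq_same, map_one, mul_one]
    simp only [map_mul, MvPolynomial.aeval_X, derivative_mul, hp, Derivation.leibniz,
      MvPolynomial.pderiv_X, map_add, smul_eq_mul, mul_add, Finset.sum_add_distrib, hsum,
      Finset.sum_mul]
    rw [add_comm, mul_comm (MvPolynomial.aeval f p)]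
    congr 1
    exact Finset.sum_congr rfl fun j _ => by ring

theorem derivative_linearSubst (N : Matrix (Fin 3) (Fin 3) ℝ) (p : MvPolynomial (Fin 3) ℝ) :
    derivative (linearSubst N p) =
      ∑ j, N j 0 • linearSubst N (MvPolynomial.pderiv j p) := by
  rw [linearSubst, derivative_aeval_eq_sum]
  refine Finset.sum_congr rfl fun j _ => ?_
  have hj : derivative (∑ i, N j i • iteratedVar i) = algebraMap ℝ _ (N j 0) := by
    rw [Algebra.algebraMap_eq_smul_one]
    simp only [iteratedVar, Fin.sum_univ_three, map_add, derivative_smul]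
    simp
  rw [hj, Algebra.smul_def]

theorem aeval_line_eq_zero {q : MvPolynomial (Fin 3) ℝ} {v b : Fin 3 → ℝ}
    (h : ∀ t : ℝ, MvPolynomial.eval (v + t • b) q = 0) :
    MvPolynomial.aeval (fun j => C (v j) + b j • (X : ℝ[X])) q = 0 := by
  refine Polynomial.funext fun t => ?_
  rw [eval_zero, ← h t, ← coe_aeval_eq_eval, ← AlgHom.comp_apply, MvPolynomial.comp_aeval,
    ← MvPolynomial.aeval_eq_eval]
  congr 2
  funext j
  simp [mul_comm]

theorem exists_eliminant_of_mul_eq_one {M N : Matrix (Fin 3) (Fin 3) ℝ} (hMN : M * N = 1)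
    {p : MvPolynomial (Fin 3) ℝ} (hp : Squarefree p) :
    ∃ R : ℝ[X][X], R ≠ 0 ∧ R.natDegree ≤ p.totalDegree ^ 2 ∧
      ∀ v b : Fin 3 → ℝ, M.mulVec v 1 = 0 → M.mulVec b 1 = 1 →
        (∀ t : ℝ, MvPolynomial.eval (v + t • b) p = 0 ∧
          ∀ i, MvPolynomial.eval (v + t • b) (MvPolynomial.pderiv i p) = 0) →
        R.IsRoot (C (M.mulVec v 2) + M.mulVec b 2 • X) := by
  obtain ⟨R, hR, hdeg, a, c, hac⟩ :=
    (totalDegreeLE_linearSubst N p).exists_eliminant (squarefree_linearSubst hMN hp)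
  refine ⟨R, hR, hdeg, fun v b hv hb h => ?_⟩
  have hNM : N * M = 1 := mul_eq_one_comm.1 hMN
  have hcoord : ∀ (u : Fin 3 → ℝ) j, ∑ i, N j i * M.mulVec u i = u j :=
    fun u j => sum_smul_sum_smul_of_mul_eq_one hNM u j
  set t : Fin 3 → ℝ[X] := fun i => C (M.mulVec v i) + M.mulVec b i • X with ht
  have hvan : ∀ q : MvPolynomial (Fin 3) ℝ, (∀ t : ℝ, MvPolynomial.eval (v + t • b) q = 0) →
      iteratedAeval t (linearSubst N q) = 0 := by
    intro q hq
    rw [iteratedAeval_linearSubst, ← aeval_line_eq_zero hq]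
    congr 2
    funext j
    simp only [ht, smul_add, Finset.sum_add_distrib, smul_C, smul_smul,
      ← Finset.sum_smul, ← map_sum, smul_eq_mul, hcoord]
  have key := congrArg (iteratedAeval t) hac
  rw [derivative_linearSubst, map_add, map_mul, map_mul, hvan p fun s => (h s).1, map_sum,
    Finset.sum_eq_zero fun j _ => ?_] at key
  · rw [zero_mul, zero_mul, add_zero] at key
    have ht1 : t 1 = X := by simp [ht, hv, hb]
    rw [IsRoot, key, iteratedAeval, aevalTower_C, ht1]
    change _ = eval₂ (Polynomial.aeval X : ℝ[X] →ₐ[ℝ] ℝ[X]).toRingHom (t 2) R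
    rw [aeval_X_left]
    rfl
  · rw [map_smul, hvan _ fun s => (h s).2 j, smul_zero]

theorem exists_forall_dotProduct_ne_zero {ι : Type*} [Finite ι] (u : ι → Fin 3 → ℝ)
    (hu : ∀ i, u i ≠ 0) : ∃ η : Fin 3 → ℝ, ∀ i, η ⬝ᵥ u i ≠ 0 := by
  obtain ⟨f, hf⟩ := Module.exists_dual_forall_apply_ne_zero (K := ℝ) u hu
  refine ⟨fun k => f (Pi.single k 1), fun i => ?_⟩
  convert hf i
  conv_rhs => rw [← Finset.univ_sum_single (u i)]
  rw [map_sum]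
  refine Finset.sum_congr rfl fun k _ => ?_
  rw [mul_comm, ← smul_eq_mul, ← map_smul, ← Pi.single_smul, smul_eq_mul, mul_one]

theorem lineSet_eq_normalized {v b η : Fin 3 → ℝ} (hb : η ⬝ᵥ b ≠ 0) :
    lineSet v b = lineSet (v - (η ⬝ᵥ v / η ⬝ᵥ b) • b) ((η ⬝ᵥ b)⁻¹ • b) := by
  ext x
  constructor
  · rintro ⟨t, rfl⟩
    refine ⟨η ⬝ᵥ v + t * η ⬝ᵥ b, ?_⟩
    rw [smul_smul, add_mul, mul_assoc, mul_inv_cancel₀ hb, ← div_eq_mul_inv]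
    module
  · rintro ⟨t, rfl⟩
    exact ⟨t * (η ⬝ᵥ b)⁻¹ - η ⬝ᵥ v / η ⬝ᵥ b, by module⟩

/-- A finite set of lines has a linear form `η` such that each line can be parametrised by `η`. -/
theorem exists_normalized_param {p : MvPolynomial (Fin 3) ℝ} {S : Finset (Set (Fin 3 → ℝ))}
    (hS : ∀ l ∈ S, l ∈ criticalLines p) :
    ∃ η : Fin 3 → ℝ, η 0 ≠ 0 ∧ ∀ l : S, ∃ v b : Fin 3 → ℝ,
      (l : Set (Fin 3 → ℝ)) = lineSet v b ∧ η ⬝ᵥ v = 0 ∧ η ⬝ᵥ b = 1 := by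
  have h : ∀ l : S, ∃ v b : Fin 3 → ℝ, b ≠ 0 ∧ (l : Set (Fin 3 → ℝ)) = lineSet v b :=
    fun l => let ⟨v, b, hb, hl, _⟩ := hS l l.2; ⟨v, b, hb, hl⟩
  choose v b hb hl using h
  obtain ⟨η, hη⟩ := exists_forall_dotProduct_ne_zero
    (fun o : Option S => o.elim (Pi.single 0 1) b) (by
      rintro (_ | l)
      · simp
      · exact hb l)
  have h0 := hη none
  refine ⟨η, by simpa using h0, fun l => ?_⟩
  have hbl : η ⬝ᵥ b l ≠ 0 := hη (some l)
  refine ⟨_, _, (hl l).trans (lineSet_eq_normalized hbl), ?_, ?_⟩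
  · rw [dotProduct_sub, dotProduct_smul, smul_eq_mul, div_mul_cancel₀ _ hbl, sub_self]
  · rw [dotProduct_smul, smul_eq_mul, inv_mul_cancel₀ hbl]

theorem card_le_of_subset_criticalLines {p : MvPolynomial (Fin 3) ℝ} (hp : Squarefree p)
    {S : Finset (Set (Fin 3 → ℝ))} (hS : ∀ l ∈ S, l ∈ criticalLines p) :
    S.card ≤ p.totalDegree ^ 2 := by
  classical
  obtain ⟨η, hη0, h⟩ := exists_normalized_param hS
  choose v b hl hv hb using h
  obtain ⟨ζ, hζ⟩ := exists_forall_dotProduct_ne_zero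
    (ι := Option {x : S × S // x.1 ≠ x.2})
    (fun o => o.elim ![-η 1, η 0, 0] fun x =>
      if b x.1.1 = b x.1.2 then v x.1.1 - v x.1.2 else b x.1.1 - b x.1.2) (by
      rintro (_ | ⟨⟨l, l'⟩, hne⟩)
      · intro h0
        exact hη0 (congrFun h0 1)
      · change (if b l = b l' then v l - v l' else b l - b l') ≠ 0
        split_ifs with hbb
        · intro h0
          refine hne (Subtype.ext ?_)
          rw [hl l, hl l', hbb, sub_eq_zero.1 h0]
        · exact sub_ne_zero.2 hbb)
  set M : Matrix (Fin 3) (Fin 3) ℝ := Matrix.of ![Pi.single 2 1, η, ζ] with hM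
  have hdet : IsUnit M.det := by
    rw [isUnit_iff_ne_zero]
    convert hζ none
    rw [Matrix.det_fin_three]
    simp [hM, dotProduct, Fin.sum_univ_three]
    ring
  obtain ⟨R, hR, hdeg, hroot⟩ := exists_eliminant_of_mul_eq_one (M.mul_nonsing_inv hdet) hp
  have h1 : ∀ u, M.mulVec u 1 = η ⬝ᵥ u := fun u => rfl
  have h2 : ∀ u, M.mulVec u 2 = ζ ⬝ᵥ u := fun u => rfl
  set r : S → ℝ[X] := fun l => C (ζ ⬝ᵥ v l) + (ζ ⬝ᵥ b l) • X with hr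
  have hinj : Function.Injective r := by
    intro l l' hll
    by_contra hne
    have hC : ζ ⬝ᵥ v l = ζ ⬝ᵥ v l' := by simpa [hr] using congrArg (fun f => f.coeff 0) hll
    have hX : ζ ⬝ᵥ b l = ζ ⬝ᵥ b l' := by
      simpa [hr, coeff_C] using congrArg (fun f => f.coeff 1) hll
    refine hζ (some ⟨(l, l'), hne⟩) ?_
    change ζ ⬝ᵥ (if b l = b l' then v l - v l' else b l - b l') = 0
    split_ifs
    · rw [dotProduct_sub, hC, sub_self]
    · rw [dotProduct_sub, hX, sub_self]
  calc S.card = (Finset.univ.image r).card := by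
        rw [Finset.card_image_of_injective _ hinj, Finset.card_univ, Fintype.card_coe]
    _ ≤ R.roots.toFinset.card := by
        refine Finset.card_le_card fun f hf => ?_
        obtain ⟨l, -, rfl⟩ := Finset.mem_image.1 hf
        rw [Multiset.mem_toFinset, mem_roots hR]
        refine hroot (v l) (b l) (hv l) (hb l) fun t => ?_
        obtain ⟨_, _, _, _, hcrit⟩ := hS l l.2
        exact hcrit _ (by rw [hl l]; exact ⟨t, rfl⟩)
    _ ≤ R.natDegree := (Multiset.toFinset_card_le _).trans (card_roots' R)
    _ ≤ p.totalDegree ^ 2 := hdeg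

theorem stmt3 (d : ℕ) (p : MvPolynomial (Fin 3) ℝ) (hp : p ≠ 0) (hsf : Squarefree p)
    (hdeg : p.totalDegree ≤ d) :
    (criticalLines p).Finite ∧ Nat.card (criticalLines p) ≤ d ^ 2 := by
  have hcard : ∀ S : Finset (Set (Fin 3 → ℝ)), (∀ l ∈ S, l ∈ criticalLines p) →
      S.card ≤ d ^ 2 := fun S hS =>
    (card_le_of_subset_criticalLines hsf hS).trans (Nat.pow_le_pow_left hdeg 2)
  have hfin : (criticalLines p).Finite := by
    by_contra hinf
    obtain ⟨S, hS, hSc⟩ := Set.Infinite.exists_subset_card_eq hinf (d ^ 2 + 1)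
    have := hcard S hS
    omega
  refine ⟨hfin, ?_⟩
  rw [Nat.card_coe_set_eq, Set.ncard_eq_toFinset_card _ hfin]
  exact hcard _ fun l hl => hfin.mem_toFinset.1 hl
end

section
/- Let F be any field and n ≥ 2. Let L be a finite collection of L lines in F^n and J the set of joints formed by L (points lying on at least n lines of L whose directions span F^n). Then |J| ≤ c_n·L^{n/(n-1)}, where c_n depends only on n. -/
universe u

/-- A subset of `Fⁿ` which is an (affine) line. -/
def IsLine {F : Type u} [Field F] {n : ℕ} (l : Set (Fin n → F)) : Prop :=
  ∃ v b : Fin n → F, b ≠ 0 ∧ l = {x | ∃ t : F, x = v + t • b}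

/-- The set of joints of a collection of lines in `Fⁿ`: points such that the directions of
the lines of the collection through the point span `Fⁿ`. -/
def jointSet {F : Type u} [Field F] {n : ℕ} (L : Finset (Set (Fin n → F))) :
    Set (Fin n → F) :=
  {x | Submodule.span F
    {b : Fin n → F | b ≠ 0 ∧ ∃ l ∈ L, x ∈ l ∧ ∃ v, l = {y | ∃ t : F, y = v + t • b}} = ⊤}

namespace MvPolynomial

theorem exists_ne_zero_totalDegree_le_of_card_lt {K σ : Type*} [Field K] [Fintype σ]
    (S : Finset (σ → K)) (k : ℕ) (hS : S.card < (k + 1) ^ Fintype.card σ) :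
    ∃ P : MvPolynomial σ K, P ≠ 0 ∧ P.totalDegree ≤ Fintype.card σ * k ∧
      ∀ x ∈ S, eval x P = 0 := by
  classical
  let e : (σ → Fin (k + 1)) → (σ →₀ ℕ) := fun m ↦ Finsupp.equivFunOnFinite.symm fun i ↦ (m i : ℕ)
  have he : Function.Injective e := fun m m' h ↦ by
    ext i
    exact DFunLike.congr_fun h i
  have hdep : ¬ LinearIndependent K
      fun (m : σ → Fin (k + 1)) (x : S) ↦ eval x.1 (monomial (e m) (1 : K)) := fun h ↦ by
    have := h.fintype_card_le_finrank
    simp at this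
    omega
  obtain ⟨g, hg, m, hm⟩ := Fintype.not_linearIndependent_iff.1 hdep
  refine ⟨∑ m, monomial (e m) (g m), fun h ↦ hm ?_, totalDegree_finsetSum_le fun m _ ↦ ?_,
    fun x hx ↦ ?_⟩
  · have := congrArg (coeff (e m)) h
    simpa [coeff_sum, coeff_monomial, he.eq_iff] using this
  · refine (totalDegree_monomial_le _ _).trans ?_
    rw [Finsupp.sum_fintype _ _ fun _ ↦ rfl, ← smul_eq_mul, ← Finset.card_univ]
    exact Finset.sum_le_card_nsmul _ _ _ fun i _ ↦ Nat.le_of_lt_succ (m i).2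
  · have := congrFun hg ⟨x, hx⟩
    simpa [eval_monomial] using this

theorem totalDegree_pderiv_lt {R σ : Type*} [CommSemiring R] {P : MvPolynomial σ R}
    {i : σ} (h : pderiv i P ≠ 0) : (pderiv i P).totalDegree < P.totalDegree := by
  classical
  obtain ⟨m, hm, hdeg⟩ := Finset.exists_mem_eq_sup _ (support_nonempty.2 h)
    fun m : σ →₀ ℕ ↦ m.sum fun _ ↦ id
  have hm' : m + Finsupp.single i 1 ∈ P.support := by
    rw [mem_support_iff, coeff_pderiv] at hm
    exact mem_support_iff.2 (left_ne_zero_of_mul hm)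
  have := le_totalDegree hm'
  rw [Finsupp.sum_add_index' (fun _ ↦ rfl) (fun _ _ _ ↦ rfl), Finsupp.sum_single_index rfl] at this
  rw [show (pderiv i P).totalDegree = _ from hdeg]
  exact this

theorem derivative_aeval {R σ : Type*} [CommRing R] [Fintype σ]
    (f : σ → Polynomial R) (P : MvPolynomial σ R) :
    (aeval f P).derivative = ∑ i, (f i).derivative * aeval f (pderiv i P) := by
  classical
  induction P using MvPolynomial.induction_on with
  | C a => simp
  | add p q hp hq => simp [hp, hq, mul_add, Finset.sum_add_distrib]
  | mul_X p j hp =>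
    simp only [map_mul, aeval_X, Polynomial.derivative_mul, hp, pderiv_mul, map_add, pderiv_X,
      Pi.single_apply, mul_add, Finset.sum_add_distrib, Finset.sum_mul, mul_assoc]
    simp [mul_comm]

theorem exists_pow_eq_of_forall_dvd {K σ : Type*} [Field K] (p : ℕ) [Fact p.Prime]
    [CharP K p] [PerfectRing K p] {P : MvPolynomial σ K}
    (h : ∀ m ∈ P.support, ∀ i, p ∣ m i) : ∃ Q, Q ^ p = P := by
  refine ⟨∑ m ∈ P.support, monomial (m.mapRange (· / p) (Nat.zero_div p))
    ((frobeniusEquiv K p).symm (coeff m P)), ?_⟩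
  rw [sum_pow_char]
  conv_rhs => rw [← support_sum_monomial_coeff P]
  refine Finset.sum_congr rfl fun m hm ↦ ?_
  rw [monomial_pow, frobeniusEquiv_symm_pow_p]
  congr 2
  ext i
  simpa using Nat.mul_div_cancel' (h m hm i)

theorem natCast_eq_zero_of_pderiv_eq_zero {R σ : Type*} [CommRing R]
    [NoZeroDivisors R] {P : MvPolynomial σ R} (h : ∀ i, pderiv i P = 0) {m : σ →₀ ℕ}
    (hm : m ∈ P.support) (i : σ) : (m i : R) = 0 := by
  classical
  rcases Nat.eq_zero_or_pos (m i) with hi | hi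
  · simp [hi]
  have hle : Finsupp.single i 1 ≤ m := by simpa using Nat.one_le_iff_ne_zero.2 hi.ne'
  have := coeff_pderiv (i := i) P (m - Finsupp.single i 1)
  rw [h i, coeff_zero, tsub_add_cancel_of_le hle] at this
  have := (mul_eq_zero.1 this.symm).resolve_left (mem_support_iff.1 hm)
  rw [Finsupp.tsub_apply, Finsupp.single_eq_same] at this
  rwa [Nat.cast_sub (Nat.succ_le_of_lt hi), Nat.cast_succ, Nat.cast_zero, zero_add,
    sub_add_cancel] at this

/-- Over a perfect field, a polynomial with vanishing gradient is constant or a power. -/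
theorem totalDegree_eq_zero_or_exists_pow_eq {K σ : Type*} [Field K] [PerfectField K]
    {P : MvPolynomial σ K} (h : ∀ i, pderiv i P = 0) :
    P.totalDegree = 0 ∨ ∃ Q, ∃ p, 2 ≤ p ∧ Q ^ p = P := by
  obtain ⟨p, hp⟩ := CharP.exists K
  rcases CharP.char_is_prime_or_zero K p with hp' | rfl
  · have := Fact.mk hp'
    have : ExpChar K p := .prime hp'
    have := PerfectField.toPerfectRing (K := K) p
    obtain ⟨Q, hQ⟩ := exists_pow_eq_of_forall_dvd p fun m hm i ↦
      (CharP.cast_eq_zero_iff K p _).1 (natCast_eq_zero_of_pderiv_eq_zero h hm i)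
    exact .inr ⟨Q, p, hp'.two_le, hQ⟩
  · have := CharP.charP_to_charZero K
    refine .inl (Nat.eq_zero_of_le_zero (Finset.sup_le fun m hm ↦ ?_))
    have : m = 0 := by
      ext i
      exact_mod_cast natCast_eq_zero_of_pderiv_eq_zero h hm i
    simp [this]

theorem totalDegree_lt_pow {R σ : Type*} [CommRing R] [IsDomain R]
    {Q : MvPolynomial σ R} {p : ℕ} (hp : 2 ≤ p) (h : (Q ^ p).totalDegree ≠ 0) :
    Q.totalDegree < (Q ^ p).totalDegree := by
  have hQ : Q ≠ 0 := by
    rintro rfl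
    exact h (by simp [show p ≠ 0 by omega])
  have h1 : Q ^ p = Q * (Q * Q ^ (p - 2)) := by
    rw [← pow_succ', ← pow_succ']
    congr 1
    omega
  rw [h1, totalDegree_mul_of_isDomain hQ (mul_ne_zero hQ (pow_ne_zero _ hQ)),
    totalDegree_mul_of_isDomain hQ (pow_ne_zero _ hQ)]
  have := totalDegree_pow Q p
  rcases Nat.eq_zero_or_pos Q.totalDegree with h0 | h0
  · simp [h0] at this
    exact absurd this h
  · omega

/-- A polynomial vanishing at more points of the line `v + K b` than its degree vanishes on the
whole line, and so does its derivative in the direction `b`. -/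
theorem sum_mul_pderiv_eq_zero {K σ : Type*} [Field K] [Fintype σ]
    {P : MvPolynomial σ K} {v b : σ → K} {T : Finset (σ → K)} (hT : ∀ x ∈ T, eval x P = 0)
    (hTl : ∀ x ∈ T, ∃ t : K, x = v + t • b) (hcard : P.totalDegree < T.card) :
    ∀ x ∈ T, ∑ i, b i * eval x (pderiv i P) = 0 := by
  classical
  let f : σ → Polynomial K := fun i ↦ .C (v i) + .C (b i) * .X
  have heval (t : K) (Q : MvPolynomial σ K) : (aeval f Q).eval t = eval (v + t • b) Q := by
    have : (Polynomial.aeval t).comp (aeval f) = aeval (R := K) (v + t • b) := by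
      ext i
      simp only [f, AlgHom.comp_apply, aeval_X, Polynomial.coe_aeval_eq_eval, Polynomial.eval_add,
        Polynomial.eval_mul, Polynomial.eval_C, Polynomial.eval_X, Pi.add_apply, Pi.smul_apply,
        smul_eq_mul, mul_comm]
    have := DFunLike.congr_fun this Q
    rwa [AlgHom.comp_apply, Polynomial.coe_aeval_eq_eval, aeval_eq_eval] at this
  choose! t ht using hTl
  have hinj : Set.InjOn t T := fun x hx y hy h ↦ by rw [ht x hx, ht y hy, h]
  have hdeg : (aeval f P).natDegree ≤ P.totalDegree := by
    have := aeval_natDegree_le P le_rfl f (n := 1) fun i ↦ ?_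
    · simpa using this
    · exact (Polynomial.natDegree_add_le _ _).trans (by
        simpa using (Polynomial.natDegree_C_mul_le _ _).trans Polynomial.natDegree_X_le)
  have hzero : aeval f P = 0 := by
    refine Polynomial.eq_zero_of_natDegree_lt_card_of_eval_eq_zero' _ (T.image t) ?_ ?_
    · simp only [Finset.mem_image, forall_exists_index, and_imp]
      rintro _ x hx rfl
      rw [heval, ← ht x hx, hT x hx]
    · rw [Finset.card_image_of_injOn hinj]
      omega
  intro x hx
  have := congrArg (Polynomial.eval (t x)) (derivative_aeval f P)
  rw [hzero] at this
  simpa [f, Polynomial.eval_finsetSum, heval, ← ht x hx] using this.symm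

end MvPolynomial

open MvPolynomial in
/-- If a nonzero polynomial vanishes on a nonempty finite set of joints, then one of the lines
contains at most as many of these joints as the degree of the polynomial. -/
theorem exists_line_card_le_totalDegree {K σ ι : Type*} [Field K] [PerfectField K] [Fintype σ]
    {I : Finset ι} {v b : ι → σ → K} {S : Finset (σ → K)} (hS : S.Nonempty)
    (hspan : ∀ x ∈ S, Submodule.span K (b '' {i | i ∈ I ∧ ∃ t : K, x = v i + t • b i}) = ⊤)
    {P : MvPolynomial σ K} (hP : P ≠ 0) (hPS : ∀ x ∈ S, eval x P = 0) :
    ∃ i ∈ I, ∃ T : Finset (σ → K), T.card ≤ P.totalDegree ∧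
      ∀ x ∈ S, (∃ t : K, x = v i + t • b i) → x ∈ T := by
  classical
  induction hd : P.totalDegree using Nat.strong_induction_on generalizing P with
  | _ d ih =>
    subst hd
    have of_lt {Q : MvPolynomial σ K} (hQ : Q ≠ 0) (hQS : ∀ x ∈ S, eval x Q = 0)
        (hlt : Q.totalDegree < P.totalDegree) : ∃ i ∈ I, ∃ T : Finset (σ → K),
          T.card ≤ P.totalDegree ∧ ∀ x ∈ S, (∃ t : K, x = v i + t • b i) → x ∈ T := by
      obtain ⟨i, hi, T, hT, h⟩ := ih _ hlt hQ hQS rfl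
      exact ⟨i, hi, T, hT.trans hlt.le, h⟩
    by_contra! hcon
    have hline (i) (hi : i ∈ I) (x) (hx : x ∈ S) (hxi : ∃ t : K, x = v i + t • b i) :
        ∑ j, b i j * eval x (pderiv j P) = 0 := by
      let T := S.filter fun x ↦ ∃ t : K, x = v i + t • b i
      refine sum_mul_pderiv_eq_zero (v := v i) (T := T)
        (fun x hx ↦ hPS x (Finset.mem_filter.1 hx).1) (fun x hx ↦ (Finset.mem_filter.1 hx).2) ?_ x (Finset.mem_filter.2 ⟨hx, hxi⟩)
      by_contra! hle
      obtain ⟨y, hy, hyi, hyT⟩ := hcon i hi T hle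
      exact hyT (Finset.mem_filter.2 ⟨hy, hyi⟩)
    have hgrad (j : σ) (x) (hx : x ∈ S) : eval x (pderiv j P) = 0 := by
      let φ : (σ → K) →ₗ[K] K := ∑ j, eval x (pderiv j P) • LinearMap.proj j
      have hφ (w : σ → K) : φ w = ∑ j, w j * eval x (pderiv j P) := by
        simp [φ, LinearMap.sum_apply, mul_comm]
      have hker : (⊤ : Submodule K (σ → K)) ≤ LinearMap.ker φ := by
        rw [← hspan x hx, Submodule.span_le]
        rintro _ ⟨i, ⟨hi, hxi⟩, rfl⟩
        rw [SetLike.mem_coe, LinearMap.mem_ker, hφ, hline i hi x hx hxi]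
      have := hker (Submodule.mem_top (x := Pi.single j 1))
      rw [LinearMap.mem_ker, hφ] at this
      simpa [Pi.single_apply] using this
    have hpd (j : σ) : pderiv j P = 0 := by
      by_contra h
      obtain ⟨i, hi, T, hT, h⟩ := of_lt h (hgrad j) (totalDegree_pderiv_lt h)
      obtain ⟨x, hx, hxi, hxT⟩ := hcon i hi T hT
      exact hxT (h x hx hxi)
    have hdeg : P.totalDegree ≠ 0 := fun h0 ↦ by
      obtain ⟨x, hx⟩ := hS
      rw [totalDegree_eq_zero_iff_eq_C] at h0
      have := hPS x hx
      rw [h0, eval_C] at this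
      exact hP (by rw [h0, this, C_0])
    obtain ⟨Q, p, hp, hQ⟩ := (totalDegree_eq_zero_or_exists_pow_eq hpd).resolve_left hdeg
    have hp0 : p ≠ 0 := by omega
    obtain ⟨i, hi, T, hT, h⟩ := of_lt (Q := Q) (by rintro rfl; exact hP (by simp [← hQ, hp0]))
      (fun x hx ↦ by simpa [← hQ, hp0] using hPS x hx)
      (hQ ▸ totalDegree_lt_pow hp (hQ ▸ hdeg))
    obtain ⟨x, hx, hxi, hxT⟩ := hcon i hi T hT
    exact hxT (h x hx hxi)

/-- The joints bound over a perfect field, for the lines `v i + K b i`. -/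
theorem card_joints_le {K σ ι : Type*} [Field K] [PerfectField K] [Fintype σ]
    (v b : ι → σ → K) (k : ℕ) (I : Finset ι) (S : Finset (σ → K))
    (hspan : ∀ x ∈ S, Submodule.span K (b '' {i | i ∈ I ∧ ∃ t : K, x = v i + t • b i}) = ⊤)
    (hS : S.card < (k + 1) ^ Fintype.card σ) :
    S.card ≤ Fintype.card σ * k * I.card := by
  classical
  induction hm : I.card generalizing I S with
  | zero =>
    rcases S.eq_empty_or_nonempty with rfl | hne
    · simp
    obtain ⟨P, hP, -, hPS⟩ := MvPolynomial.exists_ne_zero_totalDegree_le_of_card_lt S k hS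
    obtain ⟨i, hi, -⟩ := exists_line_card_le_totalDegree hne hspan hP hPS
    simp [Finset.card_eq_zero.1 hm] at hi
  | succ m ih =>
    rcases S.eq_empty_or_nonempty with rfl | hne
    · simp
    obtain ⟨P, hP, hdeg, hPS⟩ := MvPolynomial.exists_ne_zero_totalDegree_le_of_card_lt S k hS
    obtain ⟨i, hi, T, hT, hST⟩ := exists_line_card_le_totalDegree hne hspan hP hPS
    have hrest := ih (I.erase i) (S \ T) (fun x hx ↦ ?_)
      ((Finset.card_le_card Finset.sdiff_subset).trans_lt hS)
      (by rw [Finset.card_erase_of_mem hi, hm, Nat.add_sub_cancel])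
    · have := Finset.le_card_sdiff T S
      rw [mul_add, mul_one]
      omega
    · rw [Finset.mem_sdiff] at hx
      rw [← hspan x hx.1]
      congr 2
      ext j
      simp only [Finset.mem_erase, Set.mem_ofPred_eq, and_assoc, and_iff_right_iff_imp]
      rintro ⟨-, hj⟩ rfl
      exact hx.2 (hST x hx.1 hj)

/-- Extending scalars preserves spanning families of coordinate vectors. -/
theorem Submodule.span_image_algebraMap_comp_eq_top {F K σ : Type*} [Field F] [Field K]
    [Algebra F K] [Finite σ] {s : Set (σ → F)} (hs : Submodule.span F s = ⊤) :
    Submodule.span K ((algebraMap F K ∘ ·) '' s) = ⊤ := by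
  classical
  have hmem (w : σ → F) :
      algebraMap F K ∘ w ∈ Submodule.span K ((algebraMap F K ∘ ·) '' s) := by
    have hw : w ∈ Submodule.span F s := hs ▸ Submodule.mem_top
    induction hw using Submodule.span_induction with
    | mem w hw => exact Submodule.subset_span ⟨w, hw, rfl⟩
    | zero => convert Submodule.zero_mem _; ext; simp
    | add x y _ _ hx hy => convert Submodule.add_mem _ hx hy; ext; simp
    | smul a x _ hx => convert Submodule.smul_mem _ (algebraMap F K a) hx; ext; simp
  rw [eq_top_iff, ← (Pi.basisFun K σ).span_eq, Submodule.span_le]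
  rintro _ ⟨i, rfl⟩
  have hi : Pi.basisFun K σ i = algebraMap F K ∘ Pi.single i 1 := by
    ext j
    simp [Pi.single_apply, apply_ite (algebraMap F K)]
  exact hi ▸ hmem _

theorem card_le_of_subset_jointSet {F : Type*} [Field F] {n : ℕ} (k : ℕ)
    {L : Finset (Set (Fin n → F))} (hL : ∀ l ∈ L, IsLine l) {S : Finset (Fin n → F)}
    (hSL : ↑S ⊆ jointSet L) (hS : S.card < (k + 1) ^ n) : S.card ≤ n * k * L.card := by
  classical
  choose! v b hb hl using hL
  let K := AlgebraicClosure F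
  let f : (Fin n → F) → Fin n → K := (algebraMap F K ∘ ·)
  have hf : Function.Injective f := (algebraMap F K).injective.comp_left
  have key := card_joints_le (f ∘ v) (f ∘ b) k L (S.image f)
  rw [Finset.card_image_of_injective _ hf, Fintype.card_fin] at key
  refine key (fun y hy ↦ ?_) hS
  obtain ⟨x, hx, rfl⟩ := Finset.mem_image.1 hy
  have hspan : Submodule.span F (b '' {l | l ∈ L ∧ x ∈ l}) = ⊤ := by
    refine eq_top_iff.2 ((hSL hx).ge.trans (Submodule.span_le.2 ?_))
    rintro w ⟨-, l, hlL, hxl, u, hu⟩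
    have mem (t : F) : ∃ s : F, u + t • w = v l + s • b l := by
      have : u + t • w ∈ l := by
        rw [hu]
        exact ⟨t, rfl⟩
      rwa [hl l hlL] at this
    obtain ⟨s₀, h₀⟩ := mem 0
    obtain ⟨s₁, h₁⟩ := mem 1
    have hw : w = (s₁ - s₀) • b l := by
      rw [zero_smul, add_zero] at h₀
      rw [one_smul, h₀, add_assoc] at h₁
      rw [sub_smul, ← add_left_cancel h₁, add_sub_cancel_left]
    rw [hw]
    exact Submodule.smul_mem _ _ (Submodule.subset_span ⟨l, ⟨hlL, hxl⟩, rfl⟩)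
  rw [eq_top_iff, ← Submodule.span_image_algebraMap_comp_eq_top (K := K) hspan, Set.image_image]
  refine Submodule.span_mono (Set.image_mono ?_)
  rintro l ⟨hlL, hxl⟩
  rw [hl l hlL] at hxl
  obtain ⟨t, rfl⟩ := hxl
  refine ⟨hlL, algebraMap F K t, ?_⟩
  ext j
  simp [f, Algebra.smul_def]

theorem le_mul_rpow_of_forall_lt_pow {n m l : ℕ} (hn : 2 ≤ n)
    (h : ∀ k : ℕ, m < (k + 1) ^ n → m ≤ n * k * l) :
    (m : ℝ) ≤ (n : ℝ) ^ ((n : ℝ) / (n - 1)) * (l : ℝ) ^ ((n : ℝ) / (n - 1)) := by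
  rcases Nat.eq_zero_or_pos m with rfl | hm
  · simp only [Nat.cast_zero]
    positivity
  have hex : ∃ k, m < (k + 1) ^ n :=
    ⟨m, (Nat.lt_succ_self m).trans_le (Nat.le_self_pow (by omega) _)⟩
  classical
  have hkm : Nat.find hex ^ n ≤ m := by
    rcases hk : Nat.find hex with - | k
    · simp [show n ≠ 0 by omega]
    · exact not_lt.1 (Nat.find_min hex (m := k) (by omega))
  have hpow : m ^ (n - 1) ≤ (n * l) ^ n := by
    refine Nat.le_of_mul_le_mul_right ?_ hm
    calc m ^ (n - 1) * m = m ^ n := by rw [← pow_succ, Nat.sub_add_cancel (by omega)]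
      _ ≤ (n * Nat.find hex * l) ^ n := Nat.pow_le_pow_left (h _ (Nat.find_spec hex)) n
      _ = (n * l) ^ n * Nat.find hex ^ n := by ring
      _ ≤ (n * l) ^ n * m := Nat.mul_le_mul_left _ hkm
  have hn1 : (0 : ℝ) < n - 1 := by
    have : (2 : ℝ) ≤ n := by exact_mod_cast hn
    linarith
  rw [← Real.mul_rpow (by positivity) (by positivity), div_eq_mul_inv, Real.rpow_mul (by positivity),
    Real.le_rpow_inv_iff_of_pos (by positivity) (by positivity) hn1, Real.rpow_natCast,
    ← Nat.cast_pred (by omega), Real.rpow_natCast]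
  exact_mod_cast hpow

theorem stmt15 (n : ℕ) (hn : 2 ≤ n) :
    ∃ c : ℝ, ∀ (F : Type u) [Field F], ∀ L : Finset (Set (Fin n → F)),
      (∀ l ∈ L, IsLine l) →
      (jointSet L).Finite ∧
      (Nat.card (jointSet L) : ℝ) ≤ c * (L.card : ℝ) ^ ((n : ℝ) / ((n : ℝ) - 1)) := by
  refine ⟨(n : ℝ) ^ ((n : ℝ) / (n - 1)), fun F _ L hL ↦ ?_⟩
  have hbound (S : Finset (Fin n → F)) (hS : ↑S ⊆ jointSet L) :=
    le_mul_rpow_of_forall_lt_pow hn fun k ↦ card_le_of_subset_jointSet k hL hS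
  have hfin : (jointSet L).Finite := by
    by_contra hinf
    obtain ⟨m, hm⟩ := exists_nat_gt
      ((n : ℝ) ^ ((n : ℝ) / (n - 1)) * (L.card : ℝ) ^ ((n : ℝ) / (n - 1)))
    obtain ⟨S, hS, rfl⟩ := Set.Infinite.exists_subset_card_eq hinf m
    exact (hbound S hS).not_gt hm
  refine ⟨hfin, ?_⟩
  have := hbound hfin.toFinset (by simp)
  rwa [← Set.ncard_eq_toFinset_card _ hfin] at this
end
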